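/- arXiv:1909.02080 — 9 statements merged into one kernel-verified Lean document; each statement's English description precedes it below -/
import Mathlib

section
/- Let X : ℝ^N → ℝ^N be a bounded Lipschitz vector field with flow Φ (i.e., Φ(0,z) = z and (d/ds)Φ(s,z) = X(Φ(s,z)) for all s, z), and let F : ℝ^N → ℝ^k be a C¹ map such that the function XF : ℝ^N → ℝ^k defined by (XF)(w) := DF(w)[X(w)] is Lipschitz and such that F itself is Lipschitz. Suppose z, z⁺ ∈ ℝ^N and C > 0, λ₊ < 0 satisfy ‖Φ(s,z⁺) − Φ(s,z)‖ ≤ C·exp(λ₊ s) for all s ≥ 0. Then F(z⁺) − F(z) = −∫₀^{+∞} ((XF)(Φ(s,z⁺)) − (XF)(Φ(s,z))) ds, the improper integral being convergent. -/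
open MeasureTheory Set
open scoped NNReal

/-- Master Lemma 2 (forward part): for a bounded Lipschitz vector field `X` with
flow `Φ`, a `C¹` Lipschitz map `F` whose derivative along the flow
`(XF)(w) = DF(w)[X(w)]` is Lipschitz, and a forward exponential contraction
between the orbits of `z⁺` and `z`, one has
`F(z⁺) − F(z) = −∫₀^{+∞} ((XF)(Φ(s,z⁺)) − (XF)(Φ(s,z))) ds`,
the improper integral being convergent. -/
theorem stmt_2 {N k : ℕ}
    (X : EuclideanSpace ℝ (Fin N) → EuclideanSpace ℝ (Fin N))
    (BX : ℝ) (hXbd : ∀ w, ‖X w‖ ≤ BX)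
    (LX : ℝ≥0) (hXlip : LipschitzWith LX X)
    (Φ : ℝ × EuclideanSpace ℝ (Fin N) → EuclideanSpace ℝ (Fin N))
    (hΦ0 : ∀ w, Φ (0, w) = w)
    (hΦ : ∀ (w : EuclideanSpace ℝ (Fin N)) (s : ℝ),
      HasDerivAt (fun σ : ℝ => Φ (σ, w)) (X (Φ (s, w))) s)
    (F : EuclideanSpace ℝ (Fin N) → EuclideanSpace ℝ (Fin k))
    (hFC1 : ContDiff ℝ 1 F)
    (LF : ℝ≥0) (hFlip : LipschitzWith LF F)
    (LXF : ℝ≥0) (hXFlip : LipschitzWith LXF (fun w => fderiv ℝ F w (X w)))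
    (z zp : EuclideanSpace ℝ (Fin N)) (C lam : ℝ) (hC : 0 < C) (hlam : lam < 0)
    (hbound : ∀ s : ℝ, 0 ≤ s → ‖Φ (s, zp) - Φ (s, z)‖ ≤ C * Real.exp (lam * s)) :
    IntegrableOn (fun s : ℝ =>
      fderiv ℝ F (Φ (s, zp)) (X (Φ (s, zp))) - fderiv ℝ F (Φ (s, z)) (X (Φ (s, z)))) (Ici 0) ∧
    F zp - F z = -∫ s in Ici (0:ℝ),
      (fderiv ℝ F (Φ (s, zp)) (X (Φ (s, zp))) - fderiv ℝ F (Φ (s, z)) (X (Φ (s, z)))) := by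
  have hXF : Continuous fun w => fderiv ℝ F w (X w) := hXFlip.continuous
  have hΦc : ∀ w, Continuous fun σ : ℝ => Φ (σ, w) := fun w =>
    continuous_iff_continuousAt.2 fun s => (hΦ w s).continuousAt
  have hder : ∀ (w : EuclideanSpace ℝ (Fin N)) (s : ℝ),
      HasDerivAt (fun σ : ℝ => F (Φ (σ, w))) (fderiv ℝ F (Φ (s, w)) (X (Φ (s, w)))) s :=
    fun w s => ((hFC1.differentiable one_ne_zero _).hasFDerivAt).comp_hasDerivAt s (hΦ w s)
  have hint : IntegrableOn (fun s : ℝ =>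
      fderiv ℝ F (Φ (s, zp)) (X (Φ (s, zp))) - fderiv ℝ F (Φ (s, z)) (X (Φ (s, z))))
      (Ioi 0) := by
    have hg : IntegrableOn (fun s : ℝ => LXF * (C * Real.exp (lam * s))) (Ioi 0) :=
      ((integrableOn_exp_mul_Ioi hlam 0).const_mul C).const_mul _
    refine hg.mono' ((hXF.comp (hΦc zp)).sub (hXF.comp (hΦc z))).aestronglyMeasurable ?_
    filter_upwards [ae_restrict_mem measurableSet_Ioi] with s hs
    exact (hXFlip.norm_sub_le _ _).trans
      (mul_le_mul_of_nonneg_left (hbound s (le_of_lt hs)) LXF.coe_nonneg)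
  have hlim : Filter.Tendsto (fun s : ℝ => F (Φ (s, zp)) - F (Φ (s, z))) Filter.atTop
      (nhds 0) := by
    have hexp : Filter.Tendsto (fun s : ℝ => LF * (C * Real.exp (lam * s))) Filter.atTop
        (nhds 0) := by
      simpa using ((Real.tendsto_exp_atBot.comp
        (Filter.tendsto_id.const_mul_atTop_of_neg hlam)).const_mul C).const_mul (LF : ℝ)
    refine squeeze_zero_norm' ?_ hexp
    filter_upwards [Filter.eventually_ge_atTop 0] with s hs
    exact (hFlip.norm_sub_le _ _).trans
      (mul_le_mul_of_nonneg_left (hbound s hs) LF.coe_nonneg)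
  refine ⟨(integrableOn_Ici_iff_integrableOn_Ioi enorm_ne_top).2 hint, ?_⟩
  rw [integral_Ici_eq_integral_Ioi, integral_Ioi_of_hasDerivAt_of_tendsto'
    (fun s _ => (hder zp s).sub (hder z s)) hint hlim]
  simp [hΦ0]
end

section
/- Let X : ℝ^N → ℝ^N be a bounded Lipschitz vector field with flow Φ (i.e., Φ(0,z) = z and (d/ds)Φ(s,z) = X(Φ(s,z)) for all s, z), and let F : ℝ^N → ℝ^k be a C¹ map such that the function XF : ℝ^N → ℝ^k defined by (XF)(w) := DF(w)[X(w)] is Lipschitz and such that F itself is Lipschitz. Suppose z, z⁻ ∈ ℝ^N and C > 0, μ₋ > 0 satisfy ‖Φ(s,z⁻) − Φ(s,z)‖ ≤ C·exp(μ₋ s) for all s ≤ 0. Then F(z⁻) − F(z) = ∫_{−∞}^{0} ((XF)(Φ(s,z⁻)) − (XF)(Φ(s,z))) ds, the improper integral being convergent. -/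
open MeasureTheory Set
open scoped NNReal

/-- Master Lemma 2 (backward part): for a bounded Lipschitz vector field `X` with
flow `Φ`, a `C¹` Lipschitz map `F` whose derivative along the flow
`(XF)(w) = DF(w)[X(w)]` is Lipschitz, and a backward exponential contraction
between the orbits of `z⁻` and `z`, one has
`F(z⁻) − F(z) = ∫_{−∞}^{0} ((XF)(Φ(s,z⁻)) − (XF)(Φ(s,z))) ds`,
the improper integral being convergent. -/
theorem stmt_3 {N k : ℕ}
    (X : EuclideanSpace ℝ (Fin N) → EuclideanSpace ℝ (Fin N))
    (BX : ℝ) (hXbd : ∀ w, ‖X w‖ ≤ BX)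
    (LX : ℝ≥0) (hXlip : LipschitzWith LX X)
    (Φ : ℝ × EuclideanSpace ℝ (Fin N) → EuclideanSpace ℝ (Fin N))
    (hΦ0 : ∀ w, Φ (0, w) = w)
    (hΦ : ∀ (w : EuclideanSpace ℝ (Fin N)) (s : ℝ),
      HasDerivAt (fun σ : ℝ => Φ (σ, w)) (X (Φ (s, w))) s)
    (F : EuclideanSpace ℝ (Fin N) → EuclideanSpace ℝ (Fin k))
    (hFC1 : ContDiff ℝ 1 F)
    (LF : ℝ≥0) (hFlip : LipschitzWith LF F)
    (LXF : ℝ≥0) (hXFlip : LipschitzWith LXF (fun w => fderiv ℝ F w (X w)))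
    (z zm : EuclideanSpace ℝ (Fin N)) (C mu : ℝ) (hC : 0 < C) (hmu : 0 < mu)
    (hbound : ∀ s : ℝ, s ≤ 0 → ‖Φ (s, zm) - Φ (s, z)‖ ≤ C * Real.exp (mu * s)) :
    IntegrableOn (fun s : ℝ =>
      fderiv ℝ F (Φ (s, zm)) (X (Φ (s, zm))) - fderiv ℝ F (Φ (s, z)) (X (Φ (s, z)))) (Iic 0) ∧
    F zm - F z = ∫ s in Iic (0:ℝ),
      (fderiv ℝ F (Φ (s, zm)) (X (Φ (s, zm))) - fderiv ℝ F (Φ (s, z)) (X (Φ (s, z)))) := by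
  have hcont : ∀ w, Continuous fun s : ℝ => Φ (s, w) := fun w =>
    continuous_iff_continuousAt.2 fun s => (hΦ w s).continuousAt
  have hderiv : ∀ (w : EuclideanSpace ℝ (Fin N)) (s : ℝ),
      HasDerivAt (fun σ : ℝ => F (Φ (σ, w))) (fderiv ℝ F (Φ (s, w)) (X (Φ (s, w)))) s :=
    fun w s => ((hFC1.differentiable one_ne_zero) (Φ (s, w))).hasFDerivAt.comp_hasDerivAt s (hΦ w s)
  have hint : IntegrableOn (fun s : ℝ =>
      fderiv ℝ F (Φ (s, zm)) (X (Φ (s, zm))) - fderiv ℝ F (Φ (s, z)) (X (Φ (s, z)))) (Iic 0) := by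
    refine Integrable.mono'
      (((integrableOn_exp_mul_Iic hmu 0).const_mul C).const_mul (LXF : ℝ)) ?_ ?_
    · exact ((hXFlip.continuous.comp (hcont zm)).sub
        (hXFlip.continuous.comp (hcont z))).aestronglyMeasurable
    · refine (ae_restrict_iff' measurableSet_Iic).2 (.of_forall fun s hs => ?_)
      exact (hXFlip.norm_sub_le _ _).trans
        (mul_le_mul_of_nonneg_left (hbound s hs) LXF.coe_nonneg)
  have hexp : Filter.Tendsto (fun s : ℝ => LF * (C * Real.exp (mu * s))) Filter.atBot (nhds 0) := by
    simpa using ((Real.tendsto_exp_atBot.comp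
      (Filter.tendsto_id.const_mul_atBot hmu)).const_mul C).const_mul (LF : ℝ)
  have hlim : Filter.Tendsto (fun s : ℝ => F (Φ (s, zm)) - F (Φ (s, z)))
      Filter.atBot (nhds 0) := by
    refine squeeze_zero_norm' ?_ hexp
    filter_upwards [Filter.eventually_le_atBot (0 : ℝ)] with s hs
    exact (hFlip.norm_sub_le _ _).trans
      (mul_le_mul_of_nonneg_left (hbound s hs) LF.coe_nonneg)
  refine ⟨hint, ?_⟩
  rw [integral_Iic_of_hasDerivAt_of_tendsto'
    (fun s _ => (hderiv zm s).sub (hderiv z s)) hint hlim]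
  simp [hΦ0]
end

section
/- Let X⁰ : ℝ^N → ℝ^N be a Lipschitz vector field with Lipschitz constant C₀ > 0, and X¹ : ℝ^N → ℝ^N a bounded Lipschitz vector field with ‖X¹‖ ≤ C₁. For each ε ∈ [0,ε₀] let Φ_ε be the flow of X⁰ + εX¹. Let F : ℝ^N → ℝ^k be bounded and Lipschitz. Suppose there are constants C, c > 0 and λ₊ < 0 and, for each ε ∈ [0,ε₀], points z_ε, z_ε⁺ ∈ ℝ^N such that: (i) ‖Φ_ε(s,z_ε⁺) − Φ_ε(s,z_ε)‖ ≤ C·exp(λ₊ s) for all s ≥ 0 and all ε ∈ [0,ε₀]; (ii) ‖z_ε − z₀‖ ≤ cε and ‖z_ε⁺ − z₀⁺‖ ≤ cε for all ε ∈ [0,ε₀]. Then there exist ρ ∈ (0,1), K > 0 and ε₁ ∈ (0,ε₀] such that for all ε ∈ (0,ε₁]: ‖𝔍⁺(F,Φ_ε,z_ε⁺,z_ε) − 𝔍⁺(F,Φ₀,z₀⁺,z₀)‖ ≤ K·ε^{ρ}. The analogous estimate holds for 𝔍⁻ under the backward contraction hypothesis ‖Φ_ε(s,z_ε⁻) − Φ_ε(s,z_ε)‖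 ≤ C·exp(μ₋ s) for s ≤ 0 with μ₋ > 0. -/
open MeasureTheory Set
open scoped NNReal

/-- Forward Gronwall comparison of a trajectory of a perturbed Lipschitz field with a trajectory
of the unperturbed field. -/
lemma dist_perturbed_trajectory_le {E : Type*} [NormedAddCommGroup E] [NormedSpace ℝ E]
    {X : E → E} {C0 : ℝ≥0} (hC0 : 0 < C0) (hX : LipschitzWith C0 X)
    {x y r : ℝ → E} {δ₀ δ : ℝ}
    (hx : ∀ s, HasDerivAt x (X (x s) + r s) s) (hy : ∀ s, HasDerivAt y (X (y s)) s)
    (hr : ∀ s, ‖r s‖ ≤ δ) (h0 : ‖x 0 - y 0‖ ≤ δ₀) {s : ℝ} (hs : 0 ≤ s) :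
    ‖x s - y s‖ ≤ (δ₀ + δ / C0) * Real.exp (C0 * s) := by
  have hδ : 0 ≤ δ := (norm_nonneg _).trans (hr 0)
  have h := dist_le_of_approx_trajectories_ODE (v := fun _ => X) (K := C0) (f := x) (g := y)
    (f' := fun t => X (x t) + r t) (g' := fun t => X (y t)) (a := 0) (b := s)
    (εf := δ) (εg := 0) (δ := δ₀) (fun _ => hX)
    (fun t _ => (hx t).continuousAt.continuousWithinAt) (fun t _ => (hx t).hasDerivWithinAt)
    (fun t _ => by simpa [dist_eq_norm] using hr t)
    (fun t _ => (hy t).continuousAt.continuousWithinAt) (fun t _ => (hy t).hasDerivWithinAt)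
    (fun t _ => by simp) (by simpa [dist_eq_norm] using h0) s ⟨hs, le_rfl⟩
  have hC0' : (0 : ℝ) < C0 := by exact_mod_cast hC0
  rw [dist_eq_norm, gronwallBound_of_K_ne_0 hC0'.ne'] at h
  have : 0 ≤ δ / C0 := by positivity
  simp only [add_zero, sub_zero] at h
  linarith

/-- Interpolating between exponential decay of `g` and `h` and an exponentially growing bound on
`g - h` bounds the difference of their integrals by a power of the size of `g - h`. -/
lemma norm_integral_sub_integral_le_rpow {E : Type*} [NormedAddCommGroup E] [NormedSpace ℝ E]
    {g h : ℝ → E} (hg : Continuous g) (hh : Continuous h) {a L B D : ℝ} (ha : 0 < a) (hL : 0 < L)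
    (hB : 0 ≤ B) (hD : 0 ≤ D)
    (hgB : ∀ s, 0 ≤ s → ‖g s‖ ≤ B * Real.exp (-a * s))
    (hhB : ∀ s, 0 ≤ s → ‖h s‖ ≤ B * Real.exp (-a * s))
    (hgh : ∀ s, 0 ≤ s → ‖g s - h s‖ ≤ D * Real.exp (L * s)) :
    ‖(∫ s in Ioi (0 : ℝ), g s) - ∫ s in Ioi (0 : ℝ), h s‖ ≤
      (2 * B) ^ (1 - a / (2 * (L + a))) * (2 / a) * D ^ (a / (2 * (L + a))) := by
  have integrable_of_bound : ∀ {f : ℝ → E}, Continuous f →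
      (∀ s, 0 ≤ s → ‖f s‖ ≤ B * Real.exp (-a * s)) → IntegrableOn f (Ioi 0) := fun hf hfB =>
    ((exp_neg_integrableOn_Ioi 0 ha).const_mul B).mono' hf.aestronglyMeasurable
      ((ae_restrict_iff' measurableSet_Ioi).2 (.of_forall fun s hs => hfB s (le_of_lt hs)))
  rw [← integral_sub (integrable_of_bound hg hgB) (integrable_of_bound hh hhB)]
  set ρ := a / (2 * (L + a)) with hρ
  have hρ0 : 0 < ρ := by positivity
  have hρ1 : ρ < 1 := by rw [hρ, div_lt_one (by positivity)]; linarith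
  have hexp : (1 - ρ) * -a + ρ * L = -(a / 2) := by rw [hρ]; field_simp; ring
  have hpt : ∀ s ∈ Ioi (0 : ℝ),
      ‖g s - h s‖ ≤ (2 * B) ^ (1 - ρ) * D ^ ρ * Real.exp (-(a / 2) * s) := by
    intro s hs
    have hs' : 0 ≤ s := le_of_lt hs
    have h1 : ‖g s - h s‖ ≤ 2 * B * Real.exp (-a * s) := by
      linarith [norm_sub_le (g s) (h s), hgB s hs', hhB s hs']
    calc ‖g s - h s‖ = ‖g s - h s‖ ^ (1 - ρ) * ‖g s - h s‖ ^ ρ := by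
          rw [← Real.rpow_add_of_nonneg (norm_nonneg _) (by linarith) hρ0.le]; simp
      _ ≤ (2 * B * Real.exp (-a * s)) ^ (1 - ρ) * (D * Real.exp (L * s)) ^ ρ :=
          mul_le_mul (Real.rpow_le_rpow (norm_nonneg _) h1 (by linarith))
            (Real.rpow_le_rpow (norm_nonneg _) (hgh s hs') hρ0.le) (by positivity) (by positivity)
      _ = (2 * B) ^ (1 - ρ) * D ^ ρ * Real.exp (-(a / 2) * s) := by
          rw [Real.mul_rpow (by positivity) (by positivity), Real.mul_rpow hD (by positivity),
            ← Real.exp_mul, ← Real.exp_mul, ← hexp, mul_mul_mul_comm, ← Real.exp_add]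
          ring_nf
  calc _ ≤ ∫ s in Ioi (0 : ℝ), (2 * B) ^ (1 - ρ) * D ^ ρ * Real.exp (-(a / 2) * s) :=
        norm_integral_le_of_norm_le ((exp_neg_integrableOn_Ioi 0 (half_pos ha)).const_mul _)
          ((ae_restrict_iff' measurableSet_Ioi).2 (.of_forall hpt))
    _ = _ := by
        rw [integral_const_mul, integral_exp_mul_Ioi (by linarith)]
        simp only [mul_zero, Real.exp_zero]
        field_simp

/-- Comparison of the forward Melnikov integral along two exponentially asymptotic trajectories
`xp`, `x` of a perturbed field with that along trajectories `yp`, `y` of the unperturbed field. -/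
lemma norm_melnikov_sub_melnikov_le {E G : Type*} [NormedAddCommGroup E] [NormedSpace ℝ E]
    [NormedAddCommGroup G] [NormedSpace ℝ G]
    {X : E → E} {C0 : ℝ≥0} (hC0 : 0 < C0) (hX : LipschitzWith C0 X)
    {F : E → G} {LF : ℝ≥0} (hF : LipschitzWith LF F)
    {x xp y yp r rp : ℝ → E} {ε c C1 C a : ℝ} (hε : 0 ≤ ε) (hc : 0 ≤ c) (ha : 0 < a)
    (hx : ∀ s, HasDerivAt x (X (x s) + r s) s) (hxp : ∀ s, HasDerivAt xp (X (xp s) + rp s) s)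
    (hy : ∀ s, HasDerivAt y (X (y s)) s) (hyp : ∀ s, HasDerivAt yp (X (yp s)) s)
    (hr : ∀ s, ‖r s‖ ≤ ε * C1) (hrp : ∀ s, ‖rp s‖ ≤ ε * C1) (hC1 : 0 ≤ C1)
    (h0 : ‖x 0 - y 0‖ ≤ c * ε) (hp0 : ‖xp 0 - yp 0‖ ≤ c * ε)
    (hxx : ∀ s, 0 ≤ s → ‖xp s - x s‖ ≤ C * Real.exp (-a * s))
    (hyy : ∀ s, 0 ≤ s → ‖yp s - y s‖ ≤ C * Real.exp (-a * s)) :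
    ‖(∫ s in Ioi (0 : ℝ), (F (xp s) - F (x s))) - ∫ s in Ioi (0 : ℝ), (F (yp s) - F (y s))‖ ≤
      (2 * (LF * C)) ^ (1 - a / (2 * (C0 + a))) * (2 / a) *
        (2 * LF * (c + C1 / C0)) ^ (a / (2 * (C0 + a))) * ε ^ (a / (2 * (C0 + a))) := by
  have cont : ∀ {w w' : ℝ → E}, (∀ s, HasDerivAt w (w' s) s) → Continuous fun s => F (w s) :=
    fun hw => hF.continuous.comp (continuous_iff_continuousAt.2 fun s => (hw s).continuousAt)
  have hC : 0 ≤ C := by simpa using (norm_nonneg _).trans (hxx 0 le_rfl)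
  have lip : ∀ {u v : E} {b t : ℝ}, ‖u - v‖ ≤ b * t → ‖F u - F v‖ ≤ LF * b * t := by
    intro u v b t h
    rw [mul_assoc]
    exact (hF.norm_sub_le u v).trans (mul_le_mul_of_nonneg_left h LF.2)
  have hD : 0 ≤ 2 * LF * (c + C1 / C0) := by positivity
  rw [mul_assoc _ (_ ^ _) (ε ^ _), ← Real.mul_rpow hD hε]
  refine norm_integral_sub_integral_le_rpow ((cont hxp).sub (cont hx)) ((cont hyp).sub (cont hy))
    ha (by exact_mod_cast hC0) (by positivity) (by positivity) (fun s hs => lip (hxx s hs))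
    (fun s hs => lip (hyy s hs)) fun s hs => ?_
  have h1 := lip (dist_perturbed_trajectory_le hC0 hX hx hy hr h0 hs)
  have h2 := lip (dist_perturbed_trajectory_le hC0 hX hxp hyp hrp hp0 hs)
  simp only [Pi.sub_apply]
  rw [sub_sub_sub_comm]
  refine (norm_sub_le _ _).trans ((add_le_add h2 h1).trans_eq ?_)
  ring

/-- Master Lemma 3: comparison of the Melnikov integrals `𝔍⁺` (and `𝔍⁻`) along
the perturbed flow `Φ_ε` of `X⁰ + εX¹` with those along the unperturbed flow
`Φ₀`, for a bounded Lipschitz `F`: the difference is `O(ε^ρ)` for some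
`ρ ∈ (0,1)`. -/
theorem stmt_5 {N k : ℕ}
    (X0 : EuclideanSpace ℝ (Fin N) → EuclideanSpace ℝ (Fin N))
    (C0 : ℝ≥0) (hC0 : 0 < C0) (hX0lip : LipschitzWith C0 X0)
    (X1 : EuclideanSpace ℝ (Fin N) → EuclideanSpace ℝ (Fin N))
    (C1 : ℝ) (hX1bd : ∀ w, ‖X1 w‖ ≤ C1) (L1 : ℝ≥0) (hX1lip : LipschitzWith L1 X1)
    (ε₀ : ℝ) (hε₀ : 0 < ε₀)
    (Φ : ℝ → ℝ × EuclideanSpace ℝ (Fin N) → EuclideanSpace ℝ (Fin N))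
    (hflow : ∀ ε ∈ Icc (0:ℝ) ε₀,
      (∀ w, Φ ε (0, w) = w) ∧
      (∀ (w : EuclideanSpace ℝ (Fin N)) (s : ℝ),
        HasDerivAt (fun σ : ℝ => Φ ε (σ, w)) (X0 (Φ ε (s, w)) + ε • X1 (Φ ε (s, w))) s))
    (F : EuclideanSpace ℝ (Fin N) → EuclideanSpace ℝ (Fin k))
    (BF : ℝ) (hFbd : ∀ w, ‖F w‖ ≤ BF) (LF : ℝ≥0) (hFlip : LipschitzWith LF F)
    (C c : ℝ) (hC : 0 < C) (hc : 0 < c) (lam mu : ℝ) (hlam : lam < 0) (hmu : 0 < mu)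
    (z zp zm : ℝ → EuclideanSpace ℝ (Fin N))
    (hcontr_p : ∀ ε ∈ Icc (0:ℝ) ε₀, ∀ s : ℝ, 0 ≤ s →
      ‖Φ ε (s, zp ε) - Φ ε (s, z ε)‖ ≤ C * Real.exp (lam * s))
    (hcontr_m : ∀ ε ∈ Icc (0:ℝ) ε₀, ∀ s : ℝ, s ≤ 0 →
      ‖Φ ε (s, zm ε) - Φ ε (s, z ε)‖ ≤ C * Real.exp (mu * s))
    (hclose : ∀ ε ∈ Icc (0:ℝ) ε₀,
      ‖z ε - z 0‖ ≤ c * ε ∧ ‖zp ε - zp 0‖ ≤ c * ε ∧ ‖zm ε - zm 0‖ ≤ c * ε) :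
    ∃ ρ ∈ Ioo (0:ℝ) 1, ∃ K > (0:ℝ), ∃ ε₁ ∈ Ioc (0:ℝ) ε₀, ∀ ε ∈ Ioc (0:ℝ) ε₁,
      ‖(∫ s in Ici (0:ℝ), (F (Φ ε (s, zp ε)) - F (Φ ε (s, z ε)))) -
        ∫ s in Ici (0:ℝ), (F (Φ 0 (s, zp 0)) - F (Φ 0 (s, z 0)))‖ ≤ K * ε ^ ρ ∧
      ‖(∫ s in Iic (0:ℝ), (F (Φ ε (s, zm ε)) - F (Φ ε (s, z ε)))) -
        ∫ s in Iic (0:ℝ), (F (Φ 0 (s, zm 0)) - F (Φ 0 (s, z 0)))‖ ≤ K * ε ^ ρ := by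
  set a := min (-lam) mu
  have ha : 0 < a := lt_min (by linarith) hmu
  have hC0' : (0 : ℝ) < C0 := by exact_mod_cast hC0
  have hC1 : 0 ≤ C1 := (norm_nonneg _).trans (hX1bd 0)
  have h00 : (0 : ℝ) ∈ Icc 0 ε₀ := ⟨le_rfl, hε₀.le⟩
  set ρ := a / (2 * (C0 + a)) with hρ
  set K := (2 * (LF * C)) ^ (1 - ρ) * (2 / a) * (2 * LF * (c + C1 / C0)) ^ ρ
  have hK : 0 ≤ K := by positivity
  refine ⟨ρ, ⟨by positivity, ?_⟩, K + 1, by positivity, ε₀, ⟨hε₀, le_rfl⟩, fun ε hε => ?_⟩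
  · rw [hρ, div_lt_one (by positivity)]; linarith
  have hεm : ε ∈ Icc 0 ε₀ := ⟨hε.1.le, hε.2⟩
  obtain ⟨hz, hzp, hzm⟩ := hclose ε hεm
  have hKε : K * ε ^ ρ ≤ (K + 1) * ε ^ ρ :=
    mul_le_mul_of_nonneg_right (by linarith) (Real.rpow_nonneg hε.1.le _)
  have pert : ∀ w, ‖ε • X1 w‖ ≤ ε * C1 := fun w => by
    rw [norm_smul, Real.norm_of_nonneg hε.1.le]
    exact mul_le_mul_of_nonneg_left (hX1bd w) hε.1.le
  have back : ∀ {η : ℝ}, η ∈ Icc 0 ε₀ → ∀ w s, HasDerivAt (fun σ : ℝ => Φ η (-σ, w))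
      (-X0 (Φ η (-s, w)) + -(η • X1 (Φ η (-s, w)))) s := fun hη w s => by
    simpa [Function.comp_def, add_comm] using
      ((hflow _ hη).2 w (-s)).scomp s (hasDerivAt_neg s)
  have fwd0 : ∀ w s, HasDerivAt (fun σ : ℝ => Φ 0 (σ, w)) (X0 (Φ 0 (s, w))) s := fun w s => by
    simpa using (hflow 0 h00).2 w s
  have back0 : ∀ w s, HasDerivAt (fun σ : ℝ => Φ 0 (-σ, w)) (-X0 (Φ 0 (-s, w))) s :=
    fun w s => by simpa using back h00 w s
  have hX0neg : LipschitzWith C0 fun w => -X0 w := hX0lip.neg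
  have start : ∀ {w w' : EuclideanSpace ℝ (Fin N)}, ‖w - w'‖ ≤ c * ε →
      ‖Φ ε (0, w) - Φ 0 (0, w')‖ ≤ c * ε := fun h => by
    rwa [(hflow ε hεm).1, (hflow 0 h00).1]
  have contr_p : ∀ {η : ℝ}, η ∈ Icc 0 ε₀ → ∀ s, 0 ≤ s →
      ‖Φ η (s, zp η) - Φ η (s, z η)‖ ≤ C * Real.exp (-a * s) := fun hη s hs =>
    (hcontr_p _ hη s hs).trans (by gcongr; linarith [min_le_left (-lam) mu])
  have contr_m : ∀ {η : ℝ}, η ∈ Icc 0 ε₀ → ∀ s, 0 ≤ s →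
      ‖Φ η (-s, zm η) - Φ η (-s, z η)‖ ≤ C * Real.exp (-a * s) := fun hη s hs => by
    refine (hcontr_m _ hη (-s) (by linarith)).trans ?_
    rw [mul_neg, neg_mul]
    gcongr
    exact min_le_right (-lam) mu
  constructor
  · rw [integral_Ici_eq_integral_Ioi, integral_Ici_eq_integral_Ioi]
    exact (norm_melnikov_sub_melnikov_le hC0 hX0lip hFlip hε.1.le hc.le ha
      ((hflow ε hεm).2 _) ((hflow ε hεm).2 _) (fwd0 _) (fwd0 _)
      (fun _ => pert _) (fun _ => pert _) hC1 (start hz) (start hzp)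
      (contr_p hεm) (contr_p h00)).trans hKε
  · have flip : ∀ f : ℝ → EuclideanSpace ℝ (Fin k),
        ∫ s in Iic (0 : ℝ), f s = ∫ s in Ioi (0 : ℝ), f (-s) := fun f => by
      simp
    rw [flip, flip]
    exact (norm_melnikov_sub_melnikov_le hC0 hX0neg hFlip hε.1.le hc.le ha
      (back hεm _) (back hεm _) (back0 _) (back0 _)
      (fun _ => (norm_neg _).trans_le (pert _)) (fun _ => (norm_neg _).trans_le (pert _)) hC1
      (by simpa using start hz) (by simpa using start hzm)
      (contr_m hεm) (contr_m h00)).trans hKε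
end

section
/- Let X⁰ : ℝ^N → ℝ^N be a Lipschitz vector field with Lipschitz constant C₀ > 0, and X¹ : ℝ^N → ℝ^N a bounded Lipschitz vector field with ‖X¹‖ ≤ C₁. For each ε ∈ [0,ε₀] let Φ_ε be the flow of X⁰ + εX¹. Suppose there are constants C, c > 0 and λ₊ < 0 and, for each ε ∈ [0,ε₀], points z_ε, z_ε⁺ ∈ ℝ^N such that ‖Φ_ε(s,z_ε⁺) − Φ_ε(s,z_ε)‖ ≤ C·exp(λ₊ s) for all s ≥ 0, and ‖z_ε − z₀‖ ≤ cε, ‖z_ε⁺ − z₀⁺‖ ≤ cε. Let M > 0 and, for each ε ∈ [0,ε₀], let F_ε : ℝ^N → ℝ^k be a C¹ map with sup‖F_ε‖ + sup‖DF_ε‖ ≤ M·ε. Then there exist ρ ∈ (0,1), K > 0 and ε₁ ∈ (0,ε₀] such that for all ε ∈ (0,ε₁]: ‖𝔍⁺(F_ε,Φ_ε,z_ε⁺,z_ε) − 𝔍⁺(F_ε,Φ₀,z₀⁺,z₀)‖ ≤ K·ε^{1+ρ}. -/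
open MeasureTheory Set
open scoped NNReal

/-- A number below both `a` and `b` lies below their weighted geometric mean. -/
lemma le_rpow_one_sub_mul_rpow {x a b ρ : ℝ} (hx : 0 ≤ x) (hxa : x ≤ a) (hxb : x ≤ b)
    (hρ₀ : 0 ≤ ρ) (hρ₁ : ρ ≤ 1) : x ≤ a ^ (1 - ρ) * b ^ ρ := by
  calc x = x ^ (1 - ρ) * x ^ ρ := by
        rw [← Real.rpow_add_of_nonneg hx (by linarith) hρ₀, sub_add_cancel, Real.rpow_one]
    _ ≤ a ^ (1 - ρ) * b ^ ρ := by
        have := hx.trans hxa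
        gcongr

/-- Trajectories of a Lipschitz field `v` and of a perturbation of `v` of size `δ`, starting
at distance at most `η`, separate at most exponentially. -/
lemma norm_sub_le_of_perturbed_trajectory {E : Type*} [NormedAddCommGroup E] [NormedSpace ℝ E]
    {v : E → E} {K : ℝ≥0} (hK : 0 < K) (hv : LipschitzWith K v) {f f' g : ℝ → E} {δ η : ℝ}
    (hf : ∀ t, HasDerivAt f (f' t) t) (hδ : ∀ t, ‖f' t - v (f t)‖ ≤ δ)
    (hg : ∀ t, HasDerivAt g (v (g t)) t) (hη : ‖f 0 - g 0‖ ≤ η) {s : ℝ} (hs : 0 ≤ s) :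
    ‖f s - g s‖ ≤ (η + δ / K) * Real.exp (K * s) := by
  have h := dist_le_of_approx_trajectories_ODE (v := fun _ => v) (a := 0) (b := s)
    (εf := δ) (εg := 0) (fun _ => hv)
    (fun t _ => (hf t).continuousAt.continuousWithinAt) (fun t _ => (hf t).hasDerivWithinAt)
    (fun t _ => by simpa [dist_eq_norm] using hδ t)
    (fun t _ => (hg t).continuousAt.continuousWithinAt) (fun t _ => (hg t).hasDerivWithinAt)
    (fun t _ => by simp) (by simpa [dist_eq_norm] using hη) s ⟨hs, le_rfl⟩
  rw [gronwallBound_of_K_ne_0 (by positivity), dist_eq_norm] at h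
  have hδ₀ : 0 ≤ δ / K := div_nonneg ((norm_nonneg _).trans (hδ 0)) K.2
  simp only [add_zero, sub_zero] at h
  linarith

lemma integrableOn_const_mul_exp_Ici (A : ℝ) {lam : ℝ} (hlam : lam < 0) :
    IntegrableOn (fun s => A * Real.exp (lam * s)) (Ici 0) :=
  ((integrableOn_Ici_iff_integrableOn_Ioi (by simp)).2
    (integrableOn_exp_mul_Ioi hlam 0)).const_mul A

/-- A continuous function with an exponentially decaying bound is integrable on `[0, ∞)`. -/
lemma integrableOn_Ici_of_norm_le_exp {E : Type*} [NormedAddCommGroup E]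
    {f : ℝ → E} (hf : Continuous f) {A lam : ℝ} (hlam : lam < 0)
    (h : ∀ s, 0 ≤ s → ‖f s‖ ≤ A * Real.exp (lam * s)) : IntegrableOn f (Ici 0) := by
  refine (integrableOn_const_mul_exp_Ici A hlam).mono' hf.aestronglyMeasurable ?_
  filter_upwards [ae_restrict_mem measurableSet_Ici] with s hs using h s hs

/-- The integral over `[0, ∞)` of a function bounded by `A * exp (lam * s)`. -/
lemma norm_integral_Ici_le_of_norm_le_exp {E : Type*} [NormedAddCommGroup E] [NormedSpace ℝ E]
    {f : ℝ → E} {A lam : ℝ} (hlam : lam < 0)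
    (h : ∀ s, 0 ≤ s → ‖f s‖ ≤ A * Real.exp (lam * s)) :
    ‖∫ s in Ici (0 : ℝ), f s‖ ≤ A / -lam := by
  refine (norm_integral_le_of_norm_le (integrableOn_const_mul_exp_Ici A hlam) ?_).trans_eq ?_
  · filter_upwards [ae_restrict_mem measurableSet_Ici] with s hs using h s hs
  · rw [integral_Ici_eq_integral_Ioi, integral_const_mul, integral_exp_mul_Ioi hlam]
    simp [div_eq_mul_inv, inv_neg]

/-- Master Lemma 4: if the family `F_ε` is `C¹` with `sup‖F_ε‖ + sup‖DF_ε‖ ≤ M·ε`,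
then the Melnikov integrals `𝔍⁺(F_ε, Φ_ε)` and `𝔍⁺(F_ε, Φ₀)` differ by
`O(ε^{1+ρ})` for some `ρ ∈ (0,1)`. -/
theorem stmt_6 {N k : ℕ}
    (X0 : EuclideanSpace ℝ (Fin N) → EuclideanSpace ℝ (Fin N))
    (C0 : ℝ≥0) (hC0 : 0 < C0) (hX0lip : LipschitzWith C0 X0)
    (X1 : EuclideanSpace ℝ (Fin N) → EuclideanSpace ℝ (Fin N))
    (C1 : ℝ) (hX1bd : ∀ w, ‖X1 w‖ ≤ C1) (L1 : ℝ≥0) (hX1lip : LipschitzWith L1 X1)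
    (ε₀ : ℝ) (hε₀ : 0 < ε₀)
    (Φ : ℝ → ℝ × EuclideanSpace ℝ (Fin N) → EuclideanSpace ℝ (Fin N))
    (hflow : ∀ ε ∈ Icc (0:ℝ) ε₀,
      (∀ w, Φ ε (0, w) = w) ∧
      (∀ (w : EuclideanSpace ℝ (Fin N)) (s : ℝ),
        HasDerivAt (fun σ : ℝ => Φ ε (σ, w)) (X0 (Φ ε (s, w)) + ε • X1 (Φ ε (s, w))) s))
    (C c : ℝ) (hC : 0 < C) (hc : 0 < c) (lam : ℝ) (hlam : lam < 0)
    (z zp : ℝ → EuclideanSpace ℝ (Fin N))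
    (hcontr : ∀ ε ∈ Icc (0:ℝ) ε₀, ∀ s : ℝ, 0 ≤ s →
      ‖Φ ε (s, zp ε) - Φ ε (s, z ε)‖ ≤ C * Real.exp (lam * s))
    (hclose : ∀ ε ∈ Icc (0:ℝ) ε₀, ‖z ε - z 0‖ ≤ c * ε ∧ ‖zp ε - zp 0‖ ≤ c * ε)
    (M : ℝ) (hM : 0 < M)
    (F : ℝ → EuclideanSpace ℝ (Fin N) → EuclideanSpace ℝ (Fin k))
    (hFC1 : ∀ ε ∈ Icc (0:ℝ) ε₀, ContDiff ℝ 1 (F ε))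
    (hFsmall : ∀ ε ∈ Icc (0:ℝ) ε₀, ∀ w,
      ‖F ε w‖ + ‖fderiv ℝ (F ε) w‖ ≤ M * ε) :
    ∃ ρ ∈ Ioo (0:ℝ) 1, ∃ K > (0:ℝ), ∃ ε₁ ∈ Ioc (0:ℝ) ε₀, ∀ ε ∈ Ioc (0:ℝ) ε₁,
      ‖(∫ s in Ici (0:ℝ), (F ε (Φ ε (s, zp ε)) - F ε (Φ ε (s, z ε)))) -
        ∫ s in Ici (0:ℝ), (F ε (Φ 0 (s, zp 0)) - F ε (Φ 0 (s, z 0)))‖ ≤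
        K * ε ^ (1 + ρ) := by
  have hC1 : 0 ≤ C1 := (norm_nonneg _).trans (hX1bd 0)
  have hC0' : (0 : ℝ) < C0 := hC0
  set B : ℝ := max C (c + C1 / C0)
  have hB : 0 < B := hC.trans_le (le_max_left _ _)
  set ρ : ℝ := (-lam / 2) / (C0 - lam) with hρ
  have hden : 0 < (C0 : ℝ) - lam := by linarith
  have hρ₀ : 0 < ρ := div_pos (by linarith) hden
  have hρ₁ : ρ < 1 := (div_lt_one hden).2 (by linarith)
  have hrate : lam * (1 - ρ) + C0 * ρ = lam / 2 := by
    rw [hρ]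
    field_simp
    ring
  have h0mem : (0 : ℝ) ∈ Icc 0 ε₀ := ⟨le_rfl, hε₀.le⟩
  have hΦcont : ∀ ε ∈ Icc (0:ℝ) ε₀, ∀ w, Continuous fun s => Φ ε (s, w) := fun ε hε w =>
    continuous_iff_continuousAt.2 fun s => ((hflow ε hε).2 w s).continuousAt
  refine ⟨ρ, ⟨hρ₀, hρ₁⟩, 2 * M * B / -(lam / 2), div_pos (by positivity) (by linarith),
    ε₀, ⟨hε₀, le_rfl⟩, fun ε hε => ?_⟩
  have hεmem : ε ∈ Icc 0 ε₀ := ⟨hε.1.le, hε.2⟩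
  have hε_pos : 0 < ε := hε.1
  have hFlip : ∀ x y, ‖F ε x - F ε y‖ ≤ M * ε * ‖x - y‖ := fun x y =>
    convex_univ.norm_image_sub_le_of_norm_fderiv_le (𝕜 := ℝ)
      (fun w _ => ((hFC1 ε hεmem).differentiable one_ne_zero) w)
      (fun w _ => (le_add_of_nonneg_left (norm_nonneg _)).trans (hFsmall ε hεmem w))
      (mem_univ y) (mem_univ x)
  have hdecay : ∀ δ ∈ Icc (0:ℝ) ε₀, ∀ s, 0 ≤ s →
      ‖F ε (Φ δ (s, zp δ)) - F ε (Φ δ (s, z δ))‖ ≤ M * ε * (B * Real.exp (lam * s)) :=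
    fun δ hδ s hs => (hFlip _ _).trans <| by
      gcongr
      refine (hcontr δ hδ s hs).trans ?_
      gcongr
      exact le_max_left _ _
  have hintegrable : ∀ δ ∈ Icc (0:ℝ) ε₀,
      IntegrableOn (fun s => F ε (Φ δ (s, zp δ)) - F ε (Φ δ (s, z δ))) (Ici 0) := fun δ hδ =>
    integrableOn_Ici_of_norm_le_exp (A := M * ε * B)
      (((hFC1 ε hεmem).continuous.comp (hΦcont δ hδ _)).sub
        ((hFC1 ε hεmem).continuous.comp (hΦcont δ hδ _))) hlam
      fun s hs => (hdecay δ hδ s hs).trans_eq (by ring)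
  have hdrift : ∀ w w₀, ‖w - w₀‖ ≤ c * ε → ∀ s, 0 ≤ s →
      ‖F ε (Φ ε (s, w)) - F ε (Φ 0 (s, w₀))‖ ≤ M * ε * (B * (ε * Real.exp (C0 * s))) := by
    intro w w₀ hw s hs
    refine (hFlip _ _).trans ?_
    gcongr
    have h := norm_sub_le_of_perturbed_trajectory hC0 hX0lip (δ := ε * C1) (η := c * ε)
      ((hflow ε hεmem).2 w) (fun t => ?_)
      (fun t => by simpa using (hflow 0 h0mem).2 w₀ t)
      (by simpa [(hflow ε hεmem).1, (hflow 0 h0mem).1] using hw) hs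
    · calc _ ≤ _ := h
        _ = (c + C1 / C0) * (ε * Real.exp (C0 * s)) := by ring
        _ ≤ _ := by
          gcongr
          exact le_max_right _ _
    · rw [add_sub_cancel_left, norm_smul, Real.norm_of_nonneg hε_pos.le]
      gcongr
      exact hX1bd _
  rw [← integral_sub (hintegrable ε hεmem) (hintegrable 0 h0mem)]
  refine (norm_integral_Ici_le_of_norm_le_exp (A := 2 * M * B * ε ^ (1 + ρ))
    (lam := lam / 2) (by linarith) fun s hs => ?_).trans_eq (by ring)
  have hleft : ‖(F ε (Φ ε (s, zp ε)) - F ε (Φ ε (s, z ε))) -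
      (F ε (Φ 0 (s, zp 0)) - F ε (Φ 0 (s, z 0)))‖ ≤
      2 * M * B * ε * Real.exp (lam * s) := by
    refine (norm_sub_le _ _).trans ?_
    linarith [hdecay ε hεmem s hs, hdecay 0 h0mem s hs]
  have hright : ‖(F ε (Φ ε (s, zp ε)) - F ε (Φ ε (s, z ε))) -
      (F ε (Φ 0 (s, zp 0)) - F ε (Φ 0 (s, z 0)))‖ ≤
      2 * M * B * ε * (ε * Real.exp (C0 * s)) := by
    rw [sub_sub_sub_comm]
    refine (norm_sub_le _ _).trans ?_
    linarith [hdrift _ _ (hclose ε hεmem).1 s hs, hdrift _ _ (hclose ε hεmem).2 s hs]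
  have hA : 0 < 2 * M * B * ε := by positivity
  rw [← div_le_iff₀' hA] at hleft hright
  have h := le_rpow_one_sub_mul_rpow (by positivity) hleft hright hρ₀.le hρ₁.le
  rw [div_le_iff₀' hA] at h
  refine h.trans_eq ?_
  rw [Real.mul_rpow hε_pos.le (Real.exp_pos _).le, ← Real.exp_mul, ← Real.exp_mul,
    Real.rpow_add hε_pos, Real.rpow_one, ← hrate, add_mul, Real.exp_add]
  ring_nf
end

section
/- Let X⁰ : ℝ^N × ℝ → ℝ^N be continuous and uniformly Lipschitz in the first variable with Lipschitz constant C₀ > 0, and let X¹ : ℝ^N × ℝ × ℝ → ℝ^N be continuous and bounded with ‖X¹‖ ≤ C₁. Fix ε ∈ (0,1), c > 0, ρ ∈ (0,1), and 0 < k ≤ (1−ρ)/C₀, and set K = c + C₁/C₀. Let z₀ : ℝ → ℝ^N be a solution of ż = X⁰(z,t) and z_ε : ℝ → ℝ^N a solution of ż = X⁰(z,t) + ε·X¹(z,t,ε), with ‖z₀(t₀) − z_ε(t₀)‖ < c·ε. Then for all t with t₀ ≤ t ≤ t₀ + k·ln(1/ε) one has ‖z₀(t) − z_ε(t)‖ ≤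 K·ε^{ρ}. -/
open MeasureTheory Set

/-- Gronwall-type estimate: solutions of the unperturbed equation
`ż = X⁰(z,t)` and the perturbed equation `ż = X⁰(z,t) + εX¹(z,t,ε)` which
start `cε`-close stay `Kε^ρ`-close over a time interval of length
`k·ln(1/ε)`, where `k ≤ (1−ρ)/C₀` and `K = c + C₁/C₀`. -/
theorem stmt_7 {N : ℕ}
    (X0 : EuclideanSpace ℝ (Fin N) × ℝ → EuclideanSpace ℝ (Fin N))
    (hX0cont : Continuous X0)
    (C0 : ℝ) (hC0 : 0 < C0)
    (hX0lip : ∀ (z1 z2 : EuclideanSpace ℝ (Fin N)) (t : ℝ),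
      ‖X0 (z1, t) - X0 (z2, t)‖ ≤ C0 * ‖z1 - z2‖)
    (X1 : EuclideanSpace ℝ (Fin N) × ℝ × ℝ → EuclideanSpace ℝ (Fin N))
    (hX1cont : Continuous X1)
    (C1 : ℝ) (hX1bd : ∀ p, ‖X1 p‖ ≤ C1)
    (ε : ℝ) (hε : ε ∈ Ioo (0:ℝ) 1)
    (c : ℝ) (hc : 0 < c) (ρ : ℝ) (hρ : ρ ∈ Ioo (0:ℝ) 1)
    (k : ℝ) (hk : 0 < k) (hkρ : k ≤ (1 - ρ) / C0)
    (t₀ : ℝ)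
    (z0 zε : ℝ → EuclideanSpace ℝ (Fin N))
    (hz0 : ∀ t, HasDerivAt z0 (X0 (z0 t, t)) t)
    (hzε : ∀ t, HasDerivAt zε (X0 (zε t, t) + ε • X1 (zε t, t, ε)) t)
    (hinit : ‖z0 t₀ - zε t₀‖ < c * ε) :
    ∀ t : ℝ, t₀ ≤ t → t ≤ t₀ + k * Real.log (1 / ε) →
      ‖z0 t - zε t‖ ≤ (c + C1 / C0) * ε ^ ρ := by
  intro t ht ht'
  obtain ⟨hε0, hε1⟩ := hε
  have hC1 : 0 ≤ C1 := (norm_nonneg _).trans (hX1bd (0, 0, 0))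
  have hder (s : ℝ) : HasDerivAt (fun s => z0 s - zε s)
      (X0 (z0 s, s) - (X0 (zε s, s) + ε • X1 (zε s, s, ε))) s :=
    (hz0 s).sub (hzε s)
  have hgron := norm_le_gronwallBound_of_norm_deriv_right_le
    (δ := c * ε) (K := C0) (ε := ε * C1) (a := t₀) (b := t)
    (fun s _ => (hder s).continuousAt.continuousWithinAt)
    (fun s _ => (hder s).hasDerivWithinAt) hinit.le
    (fun s _ => by
      rw [← sub_sub]
      refine (norm_sub_le _ _).trans (add_le_add (hX0lip _ _ _) ?_)
      rw [norm_smul, Real.norm_of_nonneg hε0.le]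
      exact mul_le_mul_of_nonneg_left (hX1bd _) hε0.le)
    t ⟨ht, le_rfl⟩
  rw [gronwallBound_of_K_ne_0 hC0.ne'] at hgron
  have hlog : 0 ≤ -Real.log ε := neg_nonneg.2 (Real.log_nonpos hε0.le hε1.le)
  have hexp : ε * Real.exp (C0 * (t - t₀)) ≤ ε ^ ρ := by
    rw [Real.rpow_def_of_pos hε0]
    nth_rewrite 1 [← Real.exp_log hε0]
    rw [← Real.exp_add, Real.exp_le_exp]
    rw [one_div, Real.log_inv] at ht'
    have hkC : C0 * k ≤ 1 - ρ := by
      rw [mul_comm]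
      exact (le_div_iff₀ hC0).1 hkρ
    have h₁ : C0 * (t - t₀) ≤ C0 * (k * -Real.log ε) :=
      mul_le_mul_of_nonneg_left (by linarith) hC0.le
    have h₂ : C0 * k * -Real.log ε ≤ (1 - ρ) * -Real.log ε :=
      mul_le_mul_of_nonneg_right hkC hlog
    linarith
  calc ‖z0 t - zε t‖
      ≤ c * ε * Real.exp (C0 * (t - t₀))
          + ε * C1 / C0 * (Real.exp (C0 * (t - t₀)) - 1) := hgron
    _ ≤ c * ε * Real.exp (C0 * (t - t₀)) + ε * C1 / C0 * Real.exp (C0 * (t - t₀)) := by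
        gcongr
        linarith
    _ = (c + C1 / C0) * (ε * Real.exp (C0 * (t - t₀))) := by ring
    _ ≤ (c + C1 / C0) * ε ^ ρ := by gcongr
end

section
/- Let I : ℝ^N → ℝ^d be a linear projection onto d of the coordinates. Let X⁰ : ℝ^N → ℝ^N be a bounded Lipschitz vector field with I(X⁰(z)) = 0 for all z ∈ ℝ^N, and let X¹ : ℝ^N → ℝ^N be a bounded Lipschitz vector field. For each ε ∈ [0,ε₀] let Φ_ε be the flow of X⁰ + εX¹. Suppose there are constants C, c > 0, λ₊ < 0 < μ₋ and, for each ε ∈ [0,ε₀], points z_ε, z_ε⁺, z_ε⁻ ∈ ℝ^N such that: (i) ‖Φ_ε(s,z_ε⁺) − Φ_ε(s,z_ε)‖ ≤ C·exp(λ₊ s) for all s ≥ 0; (ii) ‖Φ_ε(s,z_ε⁻) − Φ_ε(s,z_ε)‖ ≤ C·exp(μ₋ s) for all s ≤ 0; (iii) ‖z_ε − z₀‖ ≤ cε, ‖z_ε⁺ − z₀⁺‖ ≤ cε, ‖z_ε⁻ − z₀⁻‖ ≤ cε; (iv) z₀⁺ = z₀⁻ =: z₀^±. Then there exist ρ ∈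 (0,1), K > 0 and ε₁ ∈ (0,ε₀] such that for all ε ∈ (0,ε₁]: ‖I(z_ε⁺) − I(z_ε⁻) + ε·∫_{−∞}^{+∞} (I(X¹(Φ₀(s,z₀^±))) − I(X¹(Φ₀(s,z₀)))) ds‖ ≤ K·ε^{1+ρ}; in other words, the change in the action coordinates by the scattering map equals −ε times the Melnikov integral of the I-component of the perturbation along the unperturbed homoclinic orbit, up to an error O(ε^{1+ρ}). -/
open MeasureTheory Set
open scoped NNReal

/-- Geometric interpolation between a decaying bound and a small but growing bound. -/
theorem le_mul_rpow_mul_exp_of_le_of_le {x M m A ρ ε s : ℝ} (hx : 0 ≤ x) (hM : 0 ≤ M)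
    (hε : 0 ≤ ε) (hρ0 : 0 < ρ) (hρ1 : ρ < 1) (hρ : ρ * (m + A) = m / 2)
    (h₁ : x ≤ M * Real.exp (-m * s)) (h₂ : x ≤ M * ε * Real.exp (A * s)) :
    x ≤ M * ε ^ ρ * Real.exp (-(m / 2) * s) := by
  have hM' : M ^ (1 - ρ) * M ^ ρ = M := by
    rw [← Real.rpow_add_of_nonneg hM (by linarith) hρ0.le]; simp
  calc x = x ^ (1 - ρ) * x ^ ρ := by
        rw [← Real.rpow_add_of_nonneg hx (by linarith) hρ0.le]; simp
    _ ≤ (M * Real.exp (-m * s)) ^ (1 - ρ) * (M * ε * Real.exp (A * s)) ^ ρ := by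
        have : 0 ≤ 1 - ρ := by linarith
        gcongr
    _ = (M ^ (1 - ρ) * M ^ ρ) * ε ^ ρ *
          (Real.exp (-m * s * (1 - ρ)) * Real.exp (A * s * ρ)) := by
        rw [Real.mul_rpow hM (Real.exp_pos _).le, Real.mul_rpow (by positivity) (Real.exp_pos _).le,
          Real.mul_rpow hM hε, ← Real.exp_mul, ← Real.exp_mul]
        ring
    _ = M * ε ^ ρ * Real.exp (-(m / 2) * s) := by
        rw [hM', ← Real.exp_add]
        congr 2
        linear_combination s * hρ

/-- Grönwall comparison of a perturbed and an unperturbed trajectory. -/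
theorem norm_sub_le_of_perturbed_trajectory_s9 {E : Type*} [NormedAddCommGroup E]
    [NormedSpace ℝ E] {X0 X1 : E → E} {L0 : ℝ≥0} {B c ε : ℝ}
    (hX0 : LipschitzWith L0 X0) (hX1 : ∀ w, ‖X1 w‖ ≤ B) (hε : 0 ≤ ε) {u u₀ : ℝ → E}
    (hu : ∀ s, HasDerivAt u (X0 (u s) + ε • X1 (u s)) s)
    (hu₀ : ∀ s, HasDerivAt u₀ (X0 (u₀ s)) s)
    (h0 : ‖u 0 - u₀ 0‖ ≤ c * ε) {s : ℝ} (hs : 0 ≤ s) :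
    ‖u s - u₀ s‖ ≤ (c + B) * ε * Real.exp ((L0 + 1) * s) := by
  have hB : 0 ≤ B := (norm_nonneg _).trans (hX1 0)
  have hlip : LipschitzWith (L0 + 1) X0 := hX0.weaken (by simp)
  have key := dist_le_of_approx_trajectories_ODE (v := fun _ => X0) (K := L0 + 1)
    (f := u) (g := u₀) (f' := fun s => X0 (u s) + ε • X1 (u s)) (g' := fun s => X0 (u₀ s))
    (a := 0) (b := s) (εf := ε * B) (εg := 0) (δ := c * ε) (fun _ => hlip)
    (fun t _ => (hu t).continuousAt.continuousWithinAt) (fun t _ => (hu t).hasDerivWithinAt)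
    (fun t _ => by
      rw [dist_eq_norm, add_sub_cancel_left, norm_smul, Real.norm_of_nonneg hε]
      exact mul_le_mul_of_nonneg_left (hX1 _) hε)
    (fun t _ => (hu₀ t).continuousAt.continuousWithinAt) (fun t _ => (hu₀ t).hasDerivWithinAt)
    (fun t _ => by simp) (by rwa [dist_eq_norm]) s ⟨hs, le_rfl⟩
  rw [dist_eq_norm, gronwallBound_of_K_ne_0 (by positivity)] at key
  refine key.trans ?_
  push_cast
  rw [sub_zero, add_zero]
  have hK : (1 : ℝ) ≤ L0 + 1 := by simp
  have hdiv : ε * B / (L0 + 1) ≤ ε * B := div_le_self (by positivity) hK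
  have hexp : 0 ≤ Real.exp ((L0 + 1) * s) - 1 := by
    have := Real.one_le_exp (x := (L0 + 1) * s) (by positivity)
    linarith
  nlinarith [mul_le_mul_of_nonneg_right hdiv hexp, mul_nonneg hε hB]

/-- The difference of a Lipschitz function along two exponentially asymptotic curves is
integrable on the half-line. -/
theorem integrableOn_Ioi_sub_of_exp_decay {E F : Type*} [NormedAddCommGroup E]
    [NormedAddCommGroup F] {G : E → F} {L : ℝ≥0} (hG : LipschitzWith L G)
    {C m : ℝ} (hm : 0 < m) {u v : ℝ → E} (hu : Continuous u) (hv : Continuous v)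
    (huv : ∀ s, 0 ≤ s → ‖u s - v s‖ ≤ C * Real.exp (-m * s)) :
    IntegrableOn (fun s => G (u s) - G (v s)) (Ioi 0) := by
  refine Integrable.mono' (((exp_neg_integrableOn_Ioi 0 hm).const_mul C).const_mul (L : ℝ)) ?_ ?_
  · exact ((hG.continuous.comp hu).sub (hG.continuous.comp hv)).aestronglyMeasurable
  · filter_upwards [ae_restrict_mem measurableSet_Ioi] with s hs
    exact (hG.norm_sub_le _ _).trans (by gcongr; exact huv s (le_of_lt hs))

/-- Along two trajectories of `X0 + ε X1` that are exponentially asymptotic, the difference of a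
conserved quantity `P` of `X0` is minus `ε` times the integral of the difference of `P ∘ X1`. -/
theorem map_sub_map_eq_neg_smul_integral {E F : Type*} [NormedAddCommGroup E]
    [NormedSpace ℝ E] [NormedAddCommGroup F] [NormedSpace ℝ F] [CompleteSpace F] {P : E →L[ℝ] F} {X0 X1 : E → E}
    {L : ℝ≥0} (hX0 : ∀ w, P (X0 w) = 0) (hX1 : LipschitzWith L (fun w => P (X1 w)))
    {C m ε : ℝ} (hm : 0 < m) {u v : ℝ → E}
    (hu : ∀ s, HasDerivAt u (X0 (u s) + ε • X1 (u s)) s)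
    (hv : ∀ s, HasDerivAt v (X0 (v s) + ε • X1 (v s)) s)
    (huv : ∀ s, 0 ≤ s → ‖u s - v s‖ ≤ C * Real.exp (-m * s)) :
    P (u 0) - P (v 0) = -(ε • ∫ s in Ioi (0 : ℝ), (P (X1 (u s)) - P (X1 (v s)))) := by
  have hcu : Continuous u := continuous_iff_continuousAt.2 fun s => (hu s).continuousAt
  have hcv : Continuous v := continuous_iff_continuousAt.2 fun s => (hv s).continuousAt
  have hint := integrableOn_Ioi_sub_of_exp_decay hX1 hm hcu hcv huv
  have hderiv : ∀ s, HasDerivAt (fun s => P (u s - v s))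
      (ε • (P (X1 (u s)) - P (X1 (v s)))) s := fun s => by
    have := P.hasFDerivAt.comp_hasDerivAt s ((hu s).sub (hv s))
    refine this.congr_deriv ?_
    simp [hX0, smul_sub]
  have hdecay : Filter.Tendsto (fun s => C * Real.exp (-m * s)) Filter.atTop (nhds 0) := by
    have : Filter.Tendsto (fun s : ℝ => -m * s) Filter.atTop Filter.atBot :=
      Filter.tendsto_id.const_mul_atTop_of_neg (by linarith)
    simpa using (Real.tendsto_exp_atBot.comp this).const_mul C
  have hsub : Filter.Tendsto (fun s => u s - v s) Filter.atTop (nhds 0) :=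
    squeeze_zero_norm' (Filter.eventually_atTop.2 ⟨0, huv⟩) hdecay
  have hlim : Filter.Tendsto (fun s => P (u s - v s)) Filter.atTop (nhds 0) := by
    have := (P.continuous.tendsto 0).comp hsub
    rwa [map_zero] at this
  have h := integral_Ioi_of_hasDerivAt_of_tendsto (hderiv 0).continuousAt.continuousWithinAt
    (fun s _ => hderiv s) (hint.smul ε) hlim
  rw [integral_smul] at h
  rw [h, zero_sub, neg_neg, map_sub]

/-- First order expansion in `ε` of the difference of a conserved quantity of `X0` between
exponentially asymptotic trajectories of `X0 + ε X1`. -/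
theorem exists_norm_map_sub_map_add_integral_le {E F : Type*} [NormedAddCommGroup E]
    [NormedSpace ℝ E] [NormedAddCommGroup F] [NormedSpace ℝ F] [CompleteSpace F]
    (P : E →L[ℝ] F) (L0 L : ℝ≥0)
    {B C c m : ℝ} (hB : 0 ≤ B) (hC : 0 < C) (hc : 0 < c) (hm : 0 < m) :
    ∃ ρ ∈ Ioo (0 : ℝ) 1, ∃ K > (0 : ℝ), ∀ X0 X1 : E → E, LipschitzWith L0 X0 →
      (∀ w, P (X0 w) = 0) → (∀ w, ‖X1 w‖ ≤ B) → LipschitzWith L (fun w => P (X1 w)) →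
      ∀ ε > (0 : ℝ), ∀ u v u₀ v₀ : ℝ → E,
      (∀ s, HasDerivAt u (X0 (u s) + ε • X1 (u s)) s) →
      (∀ s, HasDerivAt v (X0 (v s) + ε • X1 (v s)) s) →
      (∀ s, HasDerivAt u₀ (X0 (u₀ s)) s) → (∀ s, HasDerivAt v₀ (X0 (v₀ s)) s) →
      (∀ s, 0 ≤ s → ‖u s - v s‖ ≤ C * Real.exp (-m * s)) →
      (∀ s, 0 ≤ s → ‖u₀ s - v₀ s‖ ≤ C * Real.exp (-m * s)) →
      ‖u 0 - u₀ 0‖ ≤ c * ε → ‖v 0 - v₀ 0‖ ≤ c * ε →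
      ‖P (u 0) - P (v 0) + ε • ∫ s in Ioi (0 : ℝ), (P (X1 (u₀ s)) - P (X1 (v₀ s)))‖ ≤
        K * ε ^ (1 + ρ) := by
  have hA : 0 < m + ((L0 : ℝ) + 1) := by positivity
  set ρ := m / 2 / (m + ((L0 : ℝ) + 1)) with hρdef
  have hρ : ρ * (m + ((L0 : ℝ) + 1)) = m / 2 := by rw [hρdef]; field_simp
  have hρ0 : 0 < ρ := by positivity
  have hρ1 : ρ < 1 := by
    rw [hρdef, div_lt_one hA]
    have := L0.coe_nonneg
    linarith
  set M : ℝ := 2 * L * (C + (c + B)) + 1 with hMdef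
  have hM : 0 < M := by positivity
  refine ⟨ρ, ⟨hρ0, hρ1⟩, M * (2 / m), by positivity, ?_⟩
  intro X0 X1 hX0 hPX0 hX1B hX1 ε hε u v u₀ v₀ hu hv hu₀ hv₀ huv huv₀ hiu hiv
  have cont {f f' : ℝ → E} (h : ∀ s, HasDerivAt f (f' s) s) : Continuous f :=
    continuous_iff_continuousAt.2 fun s => (h s).continuousAt
  have hint := integrableOn_Ioi_sub_of_exp_decay hX1 hm (cont hu) (cont hv) huv
  have hint₀ := integrableOn_Ioi_sub_of_exp_decay hX1 hm (cont hu₀) (cont hv₀) huv₀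
  have hpt : ∀ s ∈ Ioi (0 : ℝ), ‖(P (X1 (u₀ s)) - P (X1 (v₀ s))) - (P (X1 (u s)) - P (X1 (v s)))‖
      ≤ M * ε ^ ρ * Real.exp (-(m / 2) * s) := by
    intro s hs
    have hs : 0 ≤ s := le_of_lt hs
    have hL := L.coe_nonneg
    refine le_mul_rpow_mul_exp_of_le_of_le (norm_nonneg _) hM.le hε.le hρ0 hρ1 hρ ?_ ?_
    · have h₁ := (hX1.norm_sub_le (u₀ s) (v₀ s)).trans
        (mul_le_mul_of_nonneg_left (huv₀ s hs) hL)
      have h₂ := (hX1.norm_sub_le (u s) (v s)).trans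
        (mul_le_mul_of_nonneg_left (huv s hs) hL)
      have h₃ := norm_sub_le (P (X1 (u₀ s)) - P (X1 (v₀ s))) (P (X1 (u s)) - P (X1 (v s)))
      have h₄ : 2 * L * C * Real.exp (-m * s) ≤ M * Real.exp (-m * s) := by
        gcongr
        rw [hMdef]
        nlinarith [mul_nonneg hL (add_nonneg hc.le hB)]
      linarith
    · have h₁ := (hX1.norm_sub_le (u s) (u₀ s)).trans (mul_le_mul_of_nonneg_left
        (norm_sub_le_of_perturbed_trajectory_s9 hX0 hX1B hε.le hu hu₀ hiu hs) hL)
      have h₂ := (hX1.norm_sub_le (v s) (v₀ s)).trans (mul_le_mul_of_nonneg_left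
        (norm_sub_le_of_perturbed_trajectory_s9 hX0 hX1B hε.le hv hv₀ hiv hs) hL)
      have h₃ := norm_sub_le (P (X1 (v s)) - P (X1 (v₀ s))) (P (X1 (u s)) - P (X1 (u₀ s)))
      have h₄ : 2 * L * (c + B) * (ε * Real.exp ((L0 + 1) * s))
          ≤ M * (ε * Real.exp ((L0 + 1) * s)) := by
        gcongr
        rw [hMdef]
        nlinarith [mul_nonneg hL hC.le]
      rw [show (P (X1 (u₀ s)) - P (X1 (v₀ s))) - (P (X1 (u s)) - P (X1 (v s)))
        = (P (X1 (v s)) - P (X1 (v₀ s))) - (P (X1 (u s)) - P (X1 (u₀ s))) by abel]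
      linarith
  rw [map_sub_map_eq_neg_smul_integral hPX0 hX1 hm hu hv huv, neg_add_eq_sub, ← smul_sub,
    ← integral_sub hint₀ hint, norm_smul, Real.norm_of_nonneg hε.le]
  have hm2 : 0 < m / 2 := by positivity
  have hbound := norm_integral_le_of_norm_le
    ((exp_neg_integrableOn_Ioi 0 hm2).const_mul (M * ε ^ ρ))
    ((ae_restrict_mem measurableSet_Ioi).mono hpt)
  have hval : ∫ s in Ioi (0 : ℝ), Real.exp (-(m / 2) * s) = 2 / m := by
    rw [integral_exp_mul_Ioi (by linarith)]
    simp
  rw [integral_const_mul, hval] at hbound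
  calc _ ≤ ε * (M * ε ^ ρ * (2 / m)) := by gcongr
    _ = M * (2 / m) * ε ^ (1 + ρ) := by
      rw [Real.rpow_add hε, Real.rpow_one]
      ring

/-- Change in the action by the scattering map: under the stable/unstable
fiber contraction hypotheses and `z₀⁺ = z₀⁻`, one has
`I(z_ε⁺) − I(z_ε⁻) = −ε ∫_{−∞}^{+∞} (I(X¹(Φ₀(s,z₀^±))) − I(X¹(Φ₀(s,z₀)))) ds + O(ε^{1+ρ})`. -/
theorem stmt_9 {N d : ℕ}
    (Iproj : EuclideanSpace ℝ (Fin N) → EuclideanSpace ℝ (Fin d))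
    (ι : Fin d → Fin N) (hι : Function.Injective ι)
    (hIproj : ∀ (w : EuclideanSpace ℝ (Fin N)) (j : Fin d), Iproj w j = w (ι j))
    (X0 : EuclideanSpace ℝ (Fin N) → EuclideanSpace ℝ (Fin N))
    (B0 : ℝ) (hX0bd : ∀ w, ‖X0 w‖ ≤ B0) (L0 : ℝ≥0) (hX0lip : LipschitzWith L0 X0)
    (hX0I : ∀ w, Iproj (X0 w) = 0)
    (X1 : EuclideanSpace ℝ (Fin N) → EuclideanSpace ℝ (Fin N))
    (B1 : ℝ) (hX1bd : ∀ w, ‖X1 w‖ ≤ B1) (L1 : ℝ≥0) (hX1lip : LipschitzWith L1 X1)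
    (ε₀ : ℝ) (hε₀ : 0 < ε₀)
    (Φ : ℝ → ℝ × EuclideanSpace ℝ (Fin N) → EuclideanSpace ℝ (Fin N))
    (hflow : ∀ ε ∈ Icc (0:ℝ) ε₀,
      (∀ w, Φ ε (0, w) = w) ∧
      (∀ (w : EuclideanSpace ℝ (Fin N)) (s : ℝ),
        HasDerivAt (fun σ : ℝ => Φ ε (σ, w)) (X0 (Φ ε (s, w)) + ε • X1 (Φ ε (s, w))) s))
    (C c : ℝ) (hC : 0 < C) (hc : 0 < c) (lam mu : ℝ) (hlam : lam < 0) (hmu : 0 < mu)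
    (z zp zm : ℝ → EuclideanSpace ℝ (Fin N))
    (hcontr_p : ∀ ε ∈ Icc (0:ℝ) ε₀, ∀ s : ℝ, 0 ≤ s →
      ‖Φ ε (s, zp ε) - Φ ε (s, z ε)‖ ≤ C * Real.exp (lam * s))
    (hcontr_m : ∀ ε ∈ Icc (0:ℝ) ε₀, ∀ s : ℝ, s ≤ 0 →
      ‖Φ ε (s, zm ε) - Φ ε (s, z ε)‖ ≤ C * Real.exp (mu * s))
    (hclose : ∀ ε ∈ Icc (0:ℝ) ε₀,
      ‖z ε - z 0‖ ≤ c * ε ∧ ‖zp ε - zp 0‖ ≤ c * ε ∧ ‖zm ε - zm 0‖ ≤ c * ε)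
    (hpm : zp 0 = zm 0) :
    Integrable (fun s : ℝ =>
      Iproj (X1 (Φ 0 (s, zp 0))) - Iproj (X1 (Φ 0 (s, z 0)))) ∧
    ∃ ρ ∈ Ioo (0:ℝ) 1, ∃ K > (0:ℝ), ∃ ε₁ ∈ Ioc (0:ℝ) ε₀, ∀ ε ∈ Ioc (0:ℝ) ε₁,
      ‖Iproj (zp ε) - Iproj (zm ε) +
        ε • ∫ s : ℝ, (Iproj (X1 (Φ 0 (s, zp 0))) - Iproj (X1 (Φ 0 (s, z 0))))‖ ≤
        K * ε ^ (1 + ρ) := by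
  obtain ⟨P, hP⟩ : ∃ P : EuclideanSpace ℝ (Fin N) →L[ℝ] EuclideanSpace ℝ (Fin d),
      ∀ w, Iproj w = P w :=
    ⟨LinearMap.toContinuousLinearMap
      { toFun := Iproj
        map_add' := fun a b => by ext j; simp [hIproj]
        map_smul' := fun a b => by ext j; simp [hIproj] }, fun w => rfl⟩
  simp only [hP] at hX0I ⊢
  have hLip : LipschitzWith (‖P‖₊ * L1) (fun w => P (X1 w)) := P.lipschitz.comp hX1lip
  have hm : 0 < min (-lam) mu := lt_min (by linarith) hmu
  set m := min (-lam) mu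
  have hB : 0 ≤ B1 := (norm_nonneg _).trans (hX1bd 0)
  have h0mem : (0 : ℝ) ∈ Icc (0 : ℝ) ε₀ := ⟨le_rfl, hε₀.le⟩
  have hder0 : ∀ w s, HasDerivAt (fun σ => Φ 0 (σ, w)) (X0 (Φ 0 (s, w))) s := fun w s => by
    simpa using (hflow 0 h0mem).2 w s
  have hback : ∀ ε ∈ Icc (0 : ℝ) ε₀, ∀ w s, HasDerivAt (fun σ => Φ ε (-σ, w))
      (-X0 (Φ ε (-s, w)) + ε • -X1 (Φ ε (-s, w))) s := fun ε hε w s => by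
    have := HasDerivAt.scomp (h := fun σ : ℝ => -σ) s ((hflow ε hε).2 w (-s)) (hasDerivAt_neg s)
    refine this.congr_deriv ?_
    rw [neg_smul, one_smul, neg_add, smul_neg]
  have hback0 : ∀ w s, HasDerivAt (fun σ => Φ 0 (-σ, w)) (-X0 (Φ 0 (-s, w))) s := fun w s => by
    simpa using hback 0 h0mem w s
  have hdp : ∀ ε ∈ Icc (0 : ℝ) ε₀, ∀ s, 0 ≤ s →
      ‖Φ ε (s, zp ε) - Φ ε (s, z ε)‖ ≤ C * Real.exp (-m * s) := fun ε hε s hs => by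
    refine (hcontr_p ε hε s hs).trans ?_
    have : lam ≤ -m := by linarith [min_le_left (-lam) mu]
    gcongr
  have hdm : ∀ ε ∈ Icc (0 : ℝ) ε₀, ∀ s, 0 ≤ s →
      ‖Φ ε (-s, zm ε) - Φ ε (-s, z ε)‖ ≤ C * Real.exp (-m * s) := fun ε hε s hs => by
    refine (hcontr_m ε hε (-s) (by linarith)).trans ?_
    have : m * s ≤ mu * s := by
      gcongr
      exact min_le_right _ _
    refine mul_le_mul_of_nonneg_left (Real.exp_le_exp.2 ?_) hC.le
    linarith
  have hcont : ∀ w, Continuous fun s => Φ 0 (s, w) := fun w =>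
    continuous_iff_continuousAt.2 fun s => (hder0 w s).continuousAt
  have hintp : IntegrableOn (fun s => P (X1 (Φ 0 (s, zp 0))) - P (X1 (Φ 0 (s, z 0)))) (Ioi 0) :=
    integrableOn_Ioi_sub_of_exp_decay hLip hm (hcont _) (hcont _) (hdp 0 h0mem)
  have hintm : IntegrableOn (fun s => P (X1 (Φ 0 (s, zp 0))) - P (X1 (Φ 0 (s, z 0)))) (Iic 0) := by
    have h : IntegrableOn (fun s => P (X1 (Φ 0 (-s, zm 0))) - P (X1 (Φ 0 (-s, z 0))))
        (Ioi (-0)) := by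
      rw [neg_zero]
      exact integrableOn_Ioi_sub_of_exp_decay hLip hm ((hcont (zm 0)).comp continuous_neg)
        ((hcont (z 0)).comp continuous_neg) (hdm 0 h0mem)
    rw [hpm, integrableOn_Iic_iff_integrableOn_Iio]
    simpa only [neg_neg] using h.comp_neg_Iio
  refine ⟨by rw [← integrableOn_univ, ← Iic_union_Ioi (a := (0 : ℝ))]; exact hintm.union hintp, ?_⟩
  obtain ⟨ρ, hρ, K, hK, H⟩ :=
    exists_norm_map_sub_map_add_integral_le P L0 (‖P‖₊ * L1) hB hC hc hm
  refine ⟨ρ, hρ, 2 * K, by positivity, ε₀, ⟨hε₀, le_rfl⟩, fun ε hε => ?_⟩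
  have hεmem : ε ∈ Icc (0 : ℝ) ε₀ := ⟨hε.1.le, hε.2⟩
  obtain ⟨hz, hzp, hzm⟩ := hclose ε hεmem
  have hid := (hflow ε hεmem).1
  have hid0 := (hflow 0 h0mem).1
  have Hp := H X0 X1 hX0lip hX0I hX1bd hLip ε hε.1 _ _ _ _ ((hflow ε hεmem).2 (zp ε))
    ((hflow ε hεmem).2 (z ε)) (hder0 (zp 0)) (hder0 (z 0)) (hdp ε hεmem) (hdp 0 h0mem)
    (by simpa [hid, hid0] using hzp) (by simpa [hid, hid0] using hz)
  have Hm := H (fun w => -X0 w) (fun w => -X1 w) hX0lip.neg (fun w => by simp [hX0I])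
    (fun w => by simpa using hX1bd w) (by simp only [map_neg]; exact hLip.neg) ε hε.1 _ _ _ _
    (hback ε hεmem (zm ε)) (hback ε hεmem (z ε)) (hback0 (zm 0)) (hback0 (z 0))
    (hdm ε hεmem) (hdm 0 h0mem)
    (by simpa [hid, hid0] using hzm) (by simpa [hid, hid0] using hz)
  have hneg : ∫ s in Ioi (0 : ℝ), (P (-X1 (Φ 0 (-s, zm 0))) - P (-X1 (Φ 0 (-s, z 0)))) =
      -∫ s in Iic (0 : ℝ), (P (X1 (Φ 0 (s, zp 0))) - P (X1 (Φ 0 (s, z 0)))) := by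
    have := integral_comp_neg_Ioi 0
      (fun s => P (X1 (Φ 0 (s, zp 0))) - P (X1 (Φ 0 (s, z 0))))
    rw [neg_zero] at this
    rw [← this, ← integral_neg, hpm]
    refine integral_congr_ae (Filter.Eventually.of_forall fun s => ?_)
    simp only [map_neg]
    abel
  rw [hneg] at Hm
  simp only [neg_zero, hid] at Hp Hm
  rw [← intervalIntegral.integral_Iic_add_Ioi hintm hintp]
  refine (le_of_eq ?_).trans ((norm_sub_le _ _).trans (add_le_add Hp Hm) |>.trans_eq (by ring))
  congr 1
  rw [smul_neg, smul_add]
  abel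
end

section
/- Let I, θ : ℝ^N → ℝ^d be linear projections onto two disjoint groups of d coordinates each, and let h₀ : ℝ^d → ℝ be C² with bounded and Lipschitz first and second derivatives. Let X⁰ : ℝ^N → ℝ^N be a bounded Lipschitz vector field with I(X⁰(z)) = 0 and θ(X⁰(z)) = ∇h₀(I(z)) for all z ∈ ℝ^N, and let X¹ : ℝ^N → ℝ^N be a bounded Lipschitz vector field. For each ε ∈ [0,ε₀] let Φ_ε be the flow of X⁰ + εX¹. Suppose there are constants C, c > 0, λ₊ < 0 < μ₋ and, for each ε ∈ [0,ε₀], points z_ε, z_ε⁺, z_ε⁻ ∈ ℝ^N such that: (i) ‖Φ_ε(s,z_ε⁺) − Φ_ε(s,z_ε)‖ ≤ C·exp(λ₊ s) for all s ≥ 0; (ii) ‖Φ_ε(s,z_ε⁻) − Φ_ε(s,z_ε)‖ ≤ C·exp(μ₋ s) for all s ≤ 0; (iii) ‖z_ε − z₀‖ ≤ cε, ‖z_ε⁺ − z₀⁺‖ ≤ cε, ‖z_ε⁻ − z₀⁻‖ ≤ cε; (iv) z₀⁺ = z₀⁻ =: z₀^±. Set I₀ = I(z₀^±). Then there exist ρ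 ∈ (0,1), K > 0 and ε₁ ∈ (0,ε₀] such that for all ε ∈ (0,ε₁]: ‖θ(z_ε⁺) − θ(z_ε⁻) + ε·∫_{−∞}^{+∞} (θ(X¹(Φ₀(s,z₀^±))) − θ(X¹(Φ₀(s,z₀)))) ds − ε·(∫_{−∞}^{+∞} s·(I(X¹(Φ₀(s,z₀^±))) − I(X¹(Φ₀(s,z₀)))) ds)·D²h₀(I₀)‖ ≤ K·ε^{1+ρ}, where the integral ∫ s·(...) ds is regarded as a row vector in ℝ^d and D²h₀(I₀) as a d×d matrix (the Hessian of h₀ at I₀). -/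
open MeasureTheory Set
open scoped NNReal

section Auxiliary

open Filter Topology

variable {E F : Type*} [NormedAddCommGroup E] [NormedSpace ℝ E]
  [NormedAddCommGroup F] [NormedSpace ℝ F]

theorem integrableOn_one_add_mul_exp {a : ℝ} (ha : a < 0) :
    IntegrableOn (fun s : ℝ => (1 + s) * Real.exp (a * s)) (Ioi 0) := by
  have h2 : a / 2 < 0 := by linarith
  refine Integrable.mono' ((integrableOn_exp_mul_Ioi h2 0).const_mul (1 + 2 / (-a)))
    (by fun_prop) ?_
  filter_upwards [ae_restrict_mem measurableSet_Ioi] with s hs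
  have hs : 0 < s := hs
  have h1 : Real.exp (a * s) = Real.exp (a / 2 * s) * Real.exp (a / 2 * s) := by
    rw [← Real.exp_add]; ring_nf
  have h3 : s * Real.exp (a / 2 * s) ≤ 2 / (-a) := by
    have h4 : -(a / 2 * s) + 1 ≤ Real.exp (-(a / 2 * s)) := Real.add_one_le_exp _
    rw [Real.exp_neg] at h4
    have h5 := Real.exp_pos (a / 2 * s)
    have h6 : -(a / 2 * s) * Real.exp (a / 2 * s) ≤ 1 := by
      have h7 : -(a / 2 * s) ≤ (Real.exp (a / 2 * s))⁻¹ := by linarith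
      calc _ ≤ (Real.exp (a / 2 * s))⁻¹ * Real.exp (a / 2 * s) := by gcongr
        _ = 1 := inv_mul_cancel₀ h5.ne'
    rw [le_div_iff₀ (by linarith)]
    nlinarith
  have h8 : Real.exp (a / 2 * s) ≤ 1 := Real.exp_le_one_iff.2 (by nlinarith)
  rw [Real.norm_of_nonneg (by positivity), h1]
  calc (1 + s) * (Real.exp (a / 2 * s) * Real.exp (a / 2 * s))
      = (Real.exp (a / 2 * s) + s * Real.exp (a / 2 * s)) * Real.exp (a / 2 * s) := by ring
    _ ≤ (1 + 2 / (-a)) * Real.exp (a / 2 * s) := by gcongr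

theorem le_rpow_mul_rpow_of_le {t x y ρ : ℝ} (ht : 0 ≤ t) (hx : t ≤ x) (hy : t ≤ y)
    (h0 : 0 ≤ ρ) (h1 : ρ ≤ 1) : t ≤ x ^ ρ * y ^ (1 - ρ) := by
  calc t = t ^ ρ * t ^ (1 - ρ) := by
        rw [← Real.rpow_add_of_nonneg ht h0 (by linarith)]; simp
    _ ≤ x ^ ρ * y ^ (1 - ρ) := by
        have hx0 := ht.trans hx
        gcongr

theorem norm_le_exp_of_norm_deriv_le_exp [CompleteSpace F] {f f' : ℝ → F} {A a s : ℝ} (ha : a < 0)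
    (hs : 0 ≤ s) (hf : ∀ r, HasDerivAt f (f' r) r) (hf' : Continuous f')
    (hlim : Tendsto f atTop (𝓝 0)) (hbd : ∀ r, 0 ≤ r → ‖f' r‖ ≤ A * Real.exp (a * r)) :
    ‖f s‖ ≤ A / (-a) * Real.exp (a * s) := by
  have hint := (integrableOn_exp_mul_Ioi ha s).const_mul A
  have hae : ∀ᵐ r ∂(volume.restrict (Ioi s)), ‖f' r‖ ≤ A * Real.exp (a * r) := by
    filter_upwards [ae_restrict_mem measurableSet_Ioi] with r hr
    exact hbd r (hs.trans (le_of_lt hr))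
  have h1 := integral_Ioi_of_hasDerivAt_of_tendsto (hf s).continuousAt.continuousWithinAt
    (fun r _ => hf r) (Integrable.mono' hint hf'.aestronglyMeasurable.restrict hae) hlim
  have h2 := norm_integral_le_of_norm_le hint hae
  rw [h1, integral_const_mul, integral_exp_mul_Ioi ha, zero_sub, norm_neg] at h2
  refine h2.trans (le_of_eq ?_)
  field_simp

theorem norm_sub_le_of_perturbed_flow {X0 X1 : E → E} {L0 : ℝ≥0} (hX0 : LipschitzWith L0 X0)
    {B1 : ℝ} (hX1 : ∀ w, ‖X1 w‖ ≤ B1) {ε c : ℝ} (hε : 0 ≤ ε) {x y : ℝ → E}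
    (hx : ∀ s, HasDerivAt x (X0 (x s) + ε • X1 (x s)) s)
    (hy : ∀ s, HasDerivAt y (X0 (y s)) s) (h0 : ‖x 0 - y 0‖ ≤ c * ε) {s : ℝ} (hs : 0 ≤ s) :
    ‖x s - y s‖ ≤ (c + B1) * ε * Real.exp ((L0 + 1) * s) := by
  have hB : 0 ≤ B1 := (norm_nonneg _).trans (hX1 0)
  have hd : ∀ r, HasDerivAt (fun r => x r - y r) (X0 (x r) + ε • X1 (x r) - X0 (y r)) r :=
    fun r => (hx r).sub (hy r)
  have hK : (0 : ℝ) < L0 + 1 := by positivity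
  have h := norm_le_gronwallBound_of_norm_deriv_right_le (f := fun r => x r - y r)
    (δ := c * ε) (K := L0 + 1) (ε := ε * B1) (a := 0) (b := s)
    (fun r _ => (hd r).continuousAt.continuousWithinAt)
    (fun r _ => (hd r).hasDerivWithinAt) h0 (fun r _ => ?_) s ⟨hs, le_rfl⟩
  · rw [gronwallBound_of_K_ne_0 hK.ne', sub_zero] at h
    refine h.trans ?_
    have h1 : ε * B1 / (L0 + 1) ≤ ε * B1 :=
      div_le_self (by positivity) (by linarith [L0.coe_nonneg])
    have h2 : 0 ≤ Real.exp ((L0 + 1) * s) - 1 :=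
      sub_nonneg.2 (Real.one_le_exp (by positivity))
    have h3 : 0 ≤ ε * B1 := by positivity
    nlinarith [mul_le_mul_of_nonneg_right h1 h2]
  · calc ‖X0 (x r) + ε • X1 (x r) - X0 (y r)‖ = ‖(X0 (x r) - X0 (y r)) + ε • X1 (x r)‖ := by
          congr 1; abel
      _ ≤ ‖X0 (x r) - X0 (y r)‖ + ‖ε • X1 (x r)‖ := norm_add_le _ _
      _ ≤ L0 * ‖x r - y r‖ + ε * B1 := by
          rw [norm_smul, Real.norm_of_nonneg hε]
          gcongr
          · exact hX0.norm_sub_le _ _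
          · exact hX1 _
      _ ≤ (L0 + 1) * ‖x r - y r‖ + ε * B1 := by
          gcongr
          linarith

theorem norm_sub_sub_fderiv_le {G : F → F} (hG : Differentiable ℝ G) {L : ℝ≥0}
    (hL : LipschitzWith L (fderiv ℝ G)) {p x y : F} {r : ℝ} (hx : ‖x - p‖ ≤ r)
    (hy : ‖y - p‖ ≤ r) : ‖G x - G y - fderiv ℝ G p (x - y)‖ ≤ L * r * ‖x - y‖ := by
  refine (convex_closedBall p r).norm_image_sub_le_of_norm_fderiv_le'
    (fun w _ => hG w) (fun w hw => ?_) (by simpa [dist_eq_norm] using hy)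
    (by simpa [dist_eq_norm] using hx)
  refine (hL.norm_sub_le _ _).trans ?_
  have : ‖w - p‖ ≤ r := by simpa [dist_eq_norm] using hw
  gcongr

set_option maxHeartbeats 1000000 in
/-- Angle displacement between two forward asymptotic trajectories of a perturbed rotator. -/
theorem angle_displacement_of_forward_asymptotic [CompleteSpace F] (I θ : E →L[ℝ] F)
    {G : F → F} (hG : Differentiable ℝ G)
    {LG : ℝ≥0} (hLG : LipschitzWith LG (fderiv ℝ G)) {X0 X1 : E → E}
    {L0 L1 : ℝ≥0} (hX0 : LipschitzWith L0 X0) (hI : ∀ w, I (X0 w) = 0)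
    (hθ : ∀ w, θ (X0 w) = G (I w)) {B1 : ℝ} (hX1 : ∀ w, ‖X1 w‖ ≤ B1)
    (hX1L : LipschitzWith L1 X1) {ε₀ C c a : ℝ} (hε₀ : 0 < ε₀) (hC : 0 < C) (hc : 0 < c)
    (ha : a < 0) {x y : ℝ → ℝ → E}
    (hx : ∀ ε ∈ Icc 0 ε₀, ∀ s, HasDerivAt (x ε) (X0 (x ε s) + ε • X1 (x ε s)) s)
    (hy : ∀ ε ∈ Icc 0 ε₀, ∀ s, HasDerivAt (y ε) (X0 (y ε s) + ε • X1 (y ε s)) s)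
    (hxy : ∀ ε ∈ Icc 0 ε₀, ∀ s, 0 ≤ s → ‖x ε s - y ε s‖ ≤ C * Real.exp (a * s))
    (hx0 : ∀ ε ∈ Icc 0 ε₀, ‖x ε 0 - x 0 0‖ ≤ c * ε)
    (hy0 : ∀ ε ∈ Icc 0 ε₀, ‖y ε 0 - y 0 0‖ ≤ c * ε) :
    IntegrableOn (fun s => θ (X1 (x 0 s)) - θ (X1 (y 0 s))) (Ioi 0) ∧
    IntegrableOn (fun s => s • (I (X1 (x 0 s)) - I (X1 (y 0 s)))) (Ioi 0) ∧
    ∃ ρ ∈ Ioo (0 : ℝ) 1, ∃ K > (0 : ℝ), ∀ ε ∈ Ioc 0 ε₀, ε ≤ 1 →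
      ‖θ (x ε 0) - θ (y ε 0) + ε • (∫ s in Ioi 0, (θ (X1 (x 0 s)) - θ (X1 (y 0 s)))) -
        ε • fderiv ℝ G (I (x 0 0))
          (∫ s in Ioi 0, s • (I (X1 (x 0 s)) - I (X1 (y 0 s))))‖ ≤ K * ε ^ (1 + ρ) := by
  have hB : 0 ≤ B1 := (norm_nonneg _).trans (hX1 0)
  have h00 : (0 : ℝ) ∈ Icc 0 ε₀ := ⟨le_rfl, hε₀.le⟩
  have hxc : ∀ ε ∈ Icc 0 ε₀, Continuous (x ε) := fun ε hε =>
    continuous_iff_continuousAt.2 fun s => (hx ε hε s).continuousAt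
  have hyc : ∀ ε ∈ Icc 0 ε₀, Continuous (y ε) := fun ε hε =>
    continuous_iff_continuousAt.2 fun s => (hy ε hε s).continuousAt
  set u : ℝ → ℝ → E := fun ε s => X1 (x ε s) - X1 (y ε s) with hu
  have huc : ∀ ε ∈ Icc 0 ε₀, Continuous (u ε) := fun ε hε =>
    (hX1L.continuous.comp (hxc ε hε)).sub (hX1L.continuous.comp (hyc ε hε))
  have hub : ∀ ε ∈ Icc 0 ε₀, ∀ s, 0 ≤ s → ‖u ε s‖ ≤ L1 * C * Real.exp (a * s) := by
    intro ε hε s hs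
    calc ‖u ε s‖ ≤ L1 * ‖x ε s - y ε s‖ := hX1L.norm_sub_le _ _
      _ ≤ L1 * (C * Real.exp (a * s)) := by gcongr; exact hxy ε hε s hs
      _ = _ := by ring
  set w : ℝ → ℝ := fun s => (1 + s) * Real.exp (a / 2 * s) with hw
  have hwi : IntegrableOn w (Ioi 0) := integrableOn_one_add_mul_exp (by linarith)
  have hint1 : ∀ (T : E →L[ℝ] F), ∀ ε ∈ Icc 0 ε₀,
      IntegrableOn (fun s => T (u ε s)) (Ioi 0) := by
    intro T ε hε
    refine Integrable.mono' (hwi.const_mul (‖T‖ * (L1 * C)))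
      (T.continuous.comp (huc ε hε)).aestronglyMeasurable.restrict ?_
    filter_upwards [ae_restrict_mem measurableSet_Ioi] with s hs
    have hs : 0 < s := hs
    calc ‖T (u ε s)‖ ≤ ‖T‖ * ‖u ε s‖ := T.le_opNorm _
      _ ≤ ‖T‖ * (L1 * C * Real.exp (a * s)) := by gcongr; exact hub ε hε s hs.le
      _ ≤ ‖T‖ * (L1 * C * (1 * Real.exp (a / 2 * s))) := by
          rw [one_mul]; gcongr; linarith
      _ ≤ ‖T‖ * (L1 * C * ((1 + s) * Real.exp (a / 2 * s))) := by gcongr; linarith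
      _ = _ := by ring
  have hint2 : ∀ (T : E →L[ℝ] F), ∀ ε ∈ Icc 0 ε₀,
      IntegrableOn (fun s => s • T (u ε s)) (Ioi 0) := by
    intro T ε hε
    refine Integrable.mono' (hwi.const_mul (‖T‖ * (L1 * C)))
      (continuous_id.smul (T.continuous.comp (huc ε hε))).aestronglyMeasurable.restrict ?_
    filter_upwards [ae_restrict_mem measurableSet_Ioi] with s hs
    have hs : 0 < s := hs
    calc ‖s • T (u ε s)‖ = s * ‖T (u ε s)‖ := by rw [norm_smul, Real.norm_of_nonneg hs.le]
      _ ≤ s * (‖T‖ * ‖u ε s‖) := by gcongr; exact T.le_opNorm _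
      _ ≤ s * (‖T‖ * (L1 * C * Real.exp (a * s))) := by gcongr; exact hub ε hε s hs.le
      _ ≤ (1 + s) * (‖T‖ * (L1 * C * Real.exp (a / 2 * s))) := by
          gcongr
          · linarith
          · linarith
      _ = _ := by ring
  have hsub1 : ∀ (T : E →L[ℝ] F) s, T (X1 (x 0 s)) - T (X1 (y 0 s)) = T (u 0 s) :=
    fun T s => by simp [hu]
  simp only [hsub1]
  refine ⟨hint1 θ 0 h00, hint2 I 0 h00, ?_⟩
  set D := fderiv ℝ G (I (x 0 0)) with hD
  -- the exponent is chosen so that interpolation leaves the decay rate `a / 2`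
  set k : ℝ := L0 + 1 with hk
  have hkpos : 0 < k := by positivity
  set ρ : ℝ := -a / (2 * (k - a)) with hρ
  have hka : 0 < k - a := by linarith
  have hρ0 : 0 < ρ := div_pos (by linarith) (by linarith)
  have hρ1 : ρ < 1 := by rw [hρ, div_lt_one (by linarith)]; linarith
  have hρk : ρ * k + (1 - ρ) * a = a / 2 := by rw [hρ]; field_simp; ring
  have hlimxy : ∀ ε ∈ Icc 0 ε₀, ∀ T : E →L[ℝ] F, ∀ s, 0 ≤ s →
      ‖T (x ε s - y ε s)‖ ≤ ‖T‖ * C * Real.exp (a * s) := by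
    intro ε hε T s hs
    calc ‖T (x ε s - y ε s)‖ ≤ ‖T‖ * ‖x ε s - y ε s‖ := T.le_opNorm _
      _ ≤ ‖T‖ * (C * Real.exp (a * s)) := by gcongr; exact hxy ε hε s hs
      _ = _ := by ring
  have hexplim : Tendsto (fun s => Real.exp (a * s)) atTop (𝓝 0) :=
    Real.tendsto_exp_atBot.comp (tendsto_id.const_mul_atTop_of_neg ha)
  have hdI : ∀ ε ∈ Icc 0 ε₀, ∀ s, HasDerivAt (fun s => I (x ε s - y ε s)) (ε • I (u ε s)) s := by
    intro ε hε s
    exact (I.hasFDerivAt.comp_hasDerivAt s ((hx ε hε s).fun_sub (hy ε hε s))).congr_deriv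
      (by simp [hI, hu, smul_sub])
  have hIxy : ∀ ε ∈ Icc 0 ε₀, ∀ s, 0 ≤ s →
      ‖I (x ε s - y ε s)‖ ≤ ε * (‖I‖ * (L1 * C)) / (-a) * Real.exp (a * s) := by
    intro ε hε s hs
    refine norm_le_exp_of_norm_deriv_le_exp ha hs (hdI ε hε)
      ((I.continuous.comp (huc ε hε)).const_smul ε) ?_ ?_
    · refine squeeze_zero_norm' (a := fun s => ‖I‖ * C * Real.exp (a * s)) ?_
        (by simpa using hexplim.const_mul (‖I‖ * C))
      filter_upwards [eventually_ge_atTop 0] with s hs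
      exact hlimxy ε hε I s hs
    · intro r hr
      rw [norm_smul, Real.norm_of_nonneg hε.1]
      calc ε * ‖I (u ε r)‖ ≤ ε * (‖I‖ * ‖u ε r‖) := by
            have := hε.1
            gcongr; exact I.le_opNorm _
        _ ≤ ε * (‖I‖ * (L1 * C * Real.exp (a * r))) := by
            have := hε.1
            gcongr; exact hub ε hε r hr
        _ = _ := by ring
  have hI00 : I (y 0 0) = I (x 0 0) := by
    have h := hIxy 0 h00 0 le_rfl
    rw [zero_mul, zero_div, zero_mul, norm_le_zero_iff, map_sub, sub_eq_zero] at h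
    exact h.symm
  have hdrift : ∀ ε ∈ Icc 0 ε₀, ∀ v : ℝ → E,
      (∀ s, HasDerivAt v (X0 (v s) + ε • X1 (v s)) s) → ∀ v0, ‖v 0 - v0‖ ≤ c * ε →
      I v0 = I (x 0 0) → ∀ s, 0 ≤ s →
      ‖I (v s) - I (x 0 0)‖ ≤ ε * (‖I‖ * (c + B1)) * (1 + s) := by
    intro ε hε v hv v0 hv0 hIv s hs
    have he := hε.1
    have hd : ∀ r, HasDerivAt (fun r => I (v r)) (ε • I (X1 (v r))) r := by
      intro r
      exact (I.hasFDerivAt.comp_hasDerivAt r (hv r)).congr_deriv (by simp [hI])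
    have h1 := norm_image_sub_le_of_norm_deriv_le_segment' (f := fun r => I (v r)) (a := 0) (b := s)
      (C := ε * (‖I‖ * B1)) (fun r _ => (hd r).hasDerivWithinAt) (fun r _ => by
        rw [norm_smul, Real.norm_of_nonneg hε.1]
        gcongr
        exact (I.le_opNorm _).trans (by gcongr; exact hX1 _)) s ⟨hs, le_rfl⟩
    have h2 : ‖I (v 0) - I (x 0 0)‖ ≤ ‖I‖ * (c * ε) := by
      rw [← hIv, ← map_sub]
      exact (I.le_opNorm _).trans (by gcongr)
    have h3 : 0 ≤ ‖I‖ * c * ε * s := by positivity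
    have h4 : 0 ≤ ‖I‖ * B1 * ε := by positivity
    calc ‖I (v s) - I (x 0 0)‖ = ‖(I (v s) - I (v 0)) + (I (v 0) - I (x 0 0))‖ := by
          congr 1; abel
      _ ≤ ‖I (v s) - I (v 0)‖ + ‖I (v 0) - I (x 0 0)‖ := norm_add_le _ _
      _ ≤ ε * (‖I‖ * B1) * (s - 0) + ‖I‖ * (c * ε) := add_le_add h1 h2
      _ ≤ _ := by nlinarith
  set R : ℝ → ℝ → F := fun ε s => G (I (x ε s)) - G (I (y ε s)) - D (I (x ε s) - I (y ε s)) with hR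
  have hRc : ∀ ε ∈ Icc 0 ε₀, Continuous (R ε) := by
    intro ε hε
    have h1 := I.continuous.comp (hxc ε hε)
    have h2 := I.continuous.comp (hyc ε hε)
    exact ((hG.continuous.comp h1).sub (hG.continuous.comp h2)).sub (D.continuous.comp (h1.sub h2))
  set M3 : ℝ := LG * (‖I‖ * (c + B1)) * ((‖I‖ * (L1 * C)) / (-a)) with hM3
  have hM3' : 0 ≤ M3 := by
    have : 0 < -a := by linarith
    positivity
  have hRb : ∀ ε ∈ Icc 0 ε₀, ∀ s, 0 ≤ s → ‖R ε s‖ ≤ ε ^ 2 * M3 * w s := by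
    intro ε hε s hs
    have he := hε.1
    have hna : 0 < -a := by linarith
    have h1 := hdrift ε hε (x ε) (hx ε hε) _ (hx0 ε hε) rfl s hs
    have h2 := hdrift ε hε (y ε) (hy ε hε) _ (hy0 ε hε) hI00 s hs
    have h3 := norm_sub_sub_fderiv_le hG hLG h1 h2
    have h4 := hIxy ε hε s hs
    rw [map_sub] at h4
    calc ‖R ε s‖ ≤ _ := h3
      _ ≤ LG * (ε * (‖I‖ * (c + B1)) * (1 + s)) *
          (ε * (‖I‖ * (L1 * C)) / (-a) * Real.exp (a * s)) := by gcongr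
      _ = ε ^ 2 * M3 * ((1 + s) * Real.exp (a * s)) := by rw [hM3]; ring
      _ ≤ ε ^ 2 * M3 * w s := by
          simp only [hw]
          gcongr
          linarith
  have hRi : ∀ ε ∈ Icc 0 ε₀, IntegrableOn (R ε) (Ioi 0) := by
    intro ε hε
    refine Integrable.mono' (hwi.const_mul (ε ^ 2 * M3))
      (hRc ε hε).aestronglyMeasurable.restrict ?_
    filter_upwards [ae_restrict_mem measurableSet_Ioi] with s hs
    exact hRb ε hε s (le_of_lt hs)
  set M : ℝ := c + B1 + C with hM
  have hMpos : 0 < M := by positivity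
  have hdu : ∀ ε ∈ Icc 0 ε₀, ∀ s, 0 ≤ s →
      ‖u ε s - u 0 s‖ ≤ 2 * L1 * M * ε ^ ρ * Real.exp (a / 2 * s) := by
    intro ε hε s hs
    have he := hε.1
    have hx00 : ∀ s, HasDerivAt (x 0) (X0 (x 0 s)) s := fun s => by simpa using hx 0 h00 s
    have hy00 : ∀ s, HasDerivAt (y 0) (X0 (y 0 s)) s := fun s => by simpa using hy 0 h00 s
    have h1 := norm_sub_le_of_perturbed_flow hX0 hX1 he (hx ε hε) hx00 (hx0 ε hε) hs
    have h2 := norm_sub_le_of_perturbed_flow hX0 hX1 he (hy ε hε) hy00 (hy0 ε hε) hs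
    rw [← hk] at h1 h2
    have hcB : c + B1 ≤ M := by rw [hM]; linarith
    have hCM : C ≤ M := by rw [hM]; linarith
    have hA : ‖u ε s - u 0 s‖ ≤ 2 * L1 * M * (ε * Real.exp (k * s)) := by
      calc ‖u ε s - u 0 s‖ = ‖(X1 (x ε s) - X1 (x 0 s)) - (X1 (y ε s) - X1 (y 0 s))‖ := by
            congr 1; simp only [hu]; abel
        _ ≤ ‖X1 (x ε s) - X1 (x 0 s)‖ + ‖X1 (y ε s) - X1 (y 0 s)‖ := norm_sub_le _ _
        _ ≤ L1 * ‖x ε s - x 0 s‖ + L1 * ‖y ε s - y 0 s‖ :=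
            add_le_add (hX1L.norm_sub_le _ _) (hX1L.norm_sub_le _ _)
        _ ≤ L1 * ((c + B1) * ε * Real.exp (k * s)) + L1 * ((c + B1) * ε * Real.exp (k * s)) := by
            gcongr
        _ = 2 * L1 * (c + B1) * (ε * Real.exp (k * s)) := by ring
        _ ≤ _ := by gcongr
    have hB' : ‖u ε s - u 0 s‖ ≤ 2 * L1 * M * Real.exp (a * s) := by
      calc ‖u ε s - u 0 s‖ ≤ ‖u ε s‖ + ‖u 0 s‖ := norm_sub_le _ _
        _ ≤ L1 * C * Real.exp (a * s) + L1 * C * Real.exp (a * s) :=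
            add_le_add (hub ε hε s hs) (hub 0 h00 s hs)
        _ = 2 * L1 * C * Real.exp (a * s) := by ring
        _ ≤ _ := by gcongr
    refine (le_rpow_mul_rpow_of_le (norm_nonneg _) hA hB' hρ0.le hρ1.le).trans (le_of_eq ?_)
    have hQ : 0 ≤ 2 * L1 * M := by positivity
    generalize 2 * L1 * M = Q at hQ
    rw [Real.mul_rpow hQ (by positivity), Real.mul_rpow he (by positivity),
      Real.mul_rpow hQ (by positivity), ← Real.exp_mul, ← Real.exp_mul]
    calc _ = (Q ^ ρ * Q ^ (1 - ρ)) * ε ^ ρ *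
          (Real.exp (k * s * ρ) * Real.exp (a * s * (1 - ρ))) := by ring
      _ = _ := by
        rw [← Real.rpow_add_of_nonneg hQ hρ0.le (by linarith), ← Real.exp_add, ← hρk]
        simp only [add_sub_cancel, Real.rpow_one]
        ring_nf
  have hformula : ∀ ε ∈ Icc 0 ε₀, θ (x ε 0) - θ (y ε 0) =
      -∫ s in Ioi 0, (R ε s + ε • θ (u ε s) - ε • s • D (I (u ε s))) := by
    intro ε hε
    have hd : ∀ s, HasDerivAt (fun s => θ (x ε s - y ε s) - s • D (I (x ε s - y ε s)))
        (R ε s + ε • θ (u ε s) - ε • s • D (I (u ε s))) s := by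
      intro s
      have h1 := θ.hasFDerivAt.comp_hasDerivAt s ((hx ε hε s).fun_sub (hy ε hε s))
      have h2 := (hasDerivAt_id s).fun_smul (D.hasFDerivAt.comp_hasDerivAt s (hdI ε hε s))
      refine (h1.fun_sub h2).congr_deriv ?_
      simp only [hR, hu, map_sub, map_add, map_smul, hθ, id, smul_sub, one_smul, Function.comp]
      rw [smul_comm s ε, smul_comm s ε]
      abel
    have hi : IntegrableOn (fun s => R ε s + ε • θ (u ε s) - ε • s • D (I (u ε s))) (Ioi 0) :=
      ((hRi ε hε).add ((hint1 θ ε hε).smul ε)).sub ((hint2 (D.comp I) ε hε).smul ε)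
    have hlim : Tendsto (fun s => θ (x ε s - y ε s) - s • D (I (x ε s - y ε s))) atTop (𝓝 0) := by
      have hs : Tendsto (fun s => s * Real.exp (a * s)) atTop (𝓝 0) := by
        have := Real.tendsto_pow_mul_exp_neg_atTop_nhds_zero 1
        have h2 := (this.comp (tendsto_id.const_mul_atTop (neg_pos.2 ha))).const_mul (1 / (-a))
        rw [mul_zero] at h2
        refine h2.congr fun s => ?_
        have : a ≠ 0 := ha.ne
        simp only [Function.comp, id, pow_one]
        field_simp
      refine squeeze_zero_norm'
        (a := fun s => ‖θ‖ * C * Real.exp (a * s) + ‖D.comp I‖ * C * (s * Real.exp (a * s))) ?_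
        (by simpa using (hexplim.const_mul (‖θ‖ * C)).add (hs.const_mul (‖D.comp I‖ * C)))
      filter_upwards [eventually_ge_atTop 0] with s hs
      refine (norm_sub_le _ _).trans (add_le_add (hlimxy ε hε θ s hs) ?_)
      rw [norm_smul, Real.norm_of_nonneg hs]
      calc s * ‖D (I (x ε s - y ε s))‖ ≤ s * (‖D.comp I‖ * C * Real.exp (a * s)) := by
            gcongr; exact hlimxy ε hε (D.comp I) s hs
        _ = _ := by ring
    have h := integral_Ioi_of_hasDerivAt_of_tendsto (hd 0).continuousAt.continuousWithinAt
      (fun s _ => hd s) hi hlim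
    rw [h]
    simp
  set J : ℝ := ∫ s in Ioi 0, w s with hJ
  have hJ0 : 0 ≤ J := by
    refine setIntegral_nonneg measurableSet_Ioi fun s hs => ?_
    have : (0 : ℝ) < s := hs
    positivity
  set Q : ℝ := M3 + (‖θ‖ + ‖D.comp I‖) * (2 * L1 * M) with hQ
  have hQ0 : 0 ≤ Q := by positivity
  refine ⟨ρ, ⟨hρ0, hρ1⟩, Q * J + 1, by positivity, fun ε hε' hε1 => ?_⟩
  have hε : ε ∈ Icc 0 ε₀ := ⟨hε'.1.le, hε'.2⟩
  have he : 0 < ε := hε'.1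
  have hpow : ε ^ (1 + ρ) = ε * ε ^ ρ := by rw [Real.rpow_add he, Real.rpow_one]
  have hpow2 : ε ^ 2 ≤ ε * ε ^ ρ := by
    rw [sq]
    gcongr
    simpa using Real.rpow_le_rpow_of_exponent_ge he hε1 hρ1.le
  have key : θ (x ε 0) - θ (y ε 0) + ε • (∫ s in Ioi 0, θ (u 0 s)) -
        ε • D (∫ s in Ioi 0, s • I (u 0 s)) =
      -∫ s in Ioi 0, (R ε s + ε • θ (u ε s - u 0 s) - ε • s • (D.comp I) (u ε s - u 0 s)) := by
    have e1 : D (∫ s in Ioi 0, s • I (u 0 s)) = ∫ s in Ioi 0, s • D (I (u 0 s)) := by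
      rw [← D.integral_comp_comm (hint2 I 0 h00)]
      simp
    have i1 : IntegrableOn (fun s => R ε s + ε • θ (u ε s) - ε • s • D (I (u ε s))) (Ioi 0) :=
      ((hRi ε hε).add ((hint1 θ ε hε).smul ε)).sub ((hint2 (D.comp I) ε hε).smul ε)
    have i2 : IntegrableOn (fun s => ε • θ (u 0 s)) (Ioi 0) := (hint1 θ 0 h00).smul ε
    have i3 : IntegrableOn (fun s => ε • s • D (I (u 0 s))) (Ioi 0) :=
      (hint2 (D.comp I) 0 h00).smul ε
    have e2 : ∀ s, R ε s + ε • θ (u ε s - u 0 s) - ε • s • (D.comp I) (u ε s - u 0 s) =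
        (R ε s + ε • θ (u ε s) - ε • s • D (I (u ε s))) -
          (ε • θ (u 0 s) - ε • s • D (I (u 0 s))) := fun s => by
      simp only [map_sub, smul_sub, ContinuousLinearMap.comp_apply]
      abel
    have i4 : IntegrableOn (fun s => ε • θ (u 0 s) - ε • s • D (I (u 0 s))) (Ioi 0) := i2.sub i3
    simp only [e2]
    rw [integral_sub i1 i4, integral_sub i2 i3, integral_smul, integral_smul, hformula ε hε, e1]
    abel
  rw [key, norm_neg]
  have hfin := norm_integral_le_of_norm_le (μ := volume.restrict (Ioi 0))
    (f := fun s => R ε s + ε • θ (u ε s - u 0 s) - ε • s • (D.comp I) (u ε s - u 0 s))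
    (hwi.const_mul (Q * ε ^ (1 + ρ))) ?_
  · refine hfin.trans ?_
    rw [integral_const_mul, ← hJ]
    have : 0 ≤ ε ^ (1 + ρ) := by positivity
    nlinarith
  · filter_upwards [ae_restrict_mem measurableSet_Ioi] with s hs
    have hs : 0 < s := hs
    have hb := hdu ε hε s hs.le
    have hT : ∀ T : E →L[ℝ] F, ‖T (u ε s - u 0 s)‖ ≤
        ‖T‖ * (2 * L1 * M * ε ^ ρ * Real.exp (a / 2 * s)) := fun T =>
      (T.le_opNorm _).trans (by gcongr)
    calc _ ≤ ‖R ε s‖ + ‖ε • θ (u ε s - u 0 s)‖ + ‖ε • s • (D.comp I) (u ε s - u 0 s)‖ :=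
          (norm_sub_le _ _).trans (by gcongr; exact norm_add_le _ _)
      _ = ‖R ε s‖ + ε * ‖θ (u ε s - u 0 s)‖ + ε * (s * ‖(D.comp I) (u ε s - u 0 s)‖) := by
          rw [norm_smul, norm_smul, norm_smul, Real.norm_of_nonneg he.le, Real.norm_of_nonneg hs.le]
      _ ≤ ε * ε ^ ρ * M3 * w s +
          ε * ((1 + s) * (‖θ‖ * (2 * L1 * M * ε ^ ρ * Real.exp (a / 2 * s)))) +
          ε * ((1 + s) * (‖D.comp I‖ * (2 * L1 * M * ε ^ ρ * Real.exp (a / 2 * s)))) := by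
          have hw0 : 0 ≤ w s := by positivity
          gcongr
          · exact (hRb ε hε s hs.le).trans (by gcongr)
          · refine (hT θ).trans (le_mul_of_one_le_left (by positivity) (by linarith))
          · linarith
          · exact hT (D.comp I)
      _ = Q * ε ^ (1 + ρ) * w s := by rw [hpow, hQ]; simp only [hw]; ring

end Auxiliary

theorem differentiable_gradient {F : Type*} [NormedAddCommGroup F] [InnerProductSpace ℝ F]
    [CompleteSpace F] {h : F → ℝ} (hh : ContDiff ℝ 2 h) : Differentiable ℝ (gradient h) := by
  have h1 : Differentiable ℝ (fderiv ℝ h) :=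
    (hh.fderiv_right (m := 1) (by norm_num)).differentiable one_ne_zero
  let T : (F →L[ℝ] ℝ) →L[ℝ] F :=
    { toFun := (InnerProductSpace.toDual ℝ F).symm
      map_add' := fun x y => map_add _ x y
      map_smul' := fun r x => by simp
      cont := (InnerProductSpace.toDual ℝ F).symm.continuous }
  exact T.differentiable.comp h1

theorem exists_continuousLinearMap_of_coordinates {N d : ℕ}
    {P : EuclideanSpace ℝ (Fin N) → EuclideanSpace ℝ (Fin d)} {σ : Fin d → Fin N}
    (hP : ∀ w j, P w j = w (σ j)) :
    ∃ T : EuclideanSpace ℝ (Fin N) →L[ℝ] EuclideanSpace ℝ (Fin d), P = T :=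
  ⟨LinearMap.toContinuousLinearMap
    { toFun := P
      map_add' := fun x y => by ext j; simp [hP]
      map_smul' := fun r x => by ext j; simp [hP] }, rfl⟩

theorem integrable_and_integral_eq_of_Ioi {F : Type*} [NormedAddCommGroup F] [NormedSpace ℝ F]
    {f : ℝ → F} (h1 : IntegrableOn f (Ioi 0)) (h2 : IntegrableOn (fun s => f (-s)) (Ioi 0)) :
    Integrable f ∧ ∫ s, f s = (∫ s in Ioi 0, f s) + ∫ s in Ioi 0, f (-s) := by
  have h3 : IntegrableOn f (Iic 0) := by
    rw [integrableOn_Iic_iff_integrableOn_Iio]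
    have h := IntegrableOn.comp_neg_Iio (c := (0 : ℝ)) (by simpa using h2)
    simpa using h
  refine ⟨?_, ?_⟩
  · rw [← integrableOn_univ, ← Iic_union_Ioi (a := (0 : ℝ))]
    exact h3.union h1
  · rw [integral_comp_neg_Ioi, neg_zero, add_comm, intervalIntegral.integral_Iic_add_Ioi h3 h1]

/-- Change in the angle by the scattering map: for the rotator structure
`I(X⁰)=0`, `θ(X⁰(z)) = ∇h₀(I(z))`, the angle components satisfy
`θ(z_ε⁺) − θ(z_ε⁻) = −ε ∫ (θ(X¹)∘Φ₀ diff) ds + ε (∫ s·(I(X¹)∘Φ₀ diff) ds)·D²h₀(I₀) + O(ε^{1+ρ})`,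
where the second term is the Hessian `D²h₀(I₀)` applied to the vector
`∫ s·(I(X¹(Φ₀(s,z₀^±))) − I(X¹(Φ₀(s,z₀)))) ds`. -/
theorem stmt_10 {N d : ℕ}
    (Iproj θproj : EuclideanSpace ℝ (Fin N) → EuclideanSpace ℝ (Fin d))
    (ι κ : Fin d → Fin N) (hι : Function.Injective ι) (hκ : Function.Injective κ)
    (hdisj : ∀ i j, ι i ≠ κ j)
    (hIproj : ∀ (w : EuclideanSpace ℝ (Fin N)) (j : Fin d), Iproj w j = w (ι j))
    (hθproj : ∀ (w : EuclideanSpace ℝ (Fin N)) (j : Fin d), θproj w j = w (κ j))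
    (h₀ : EuclideanSpace ℝ (Fin d) → ℝ) (hh₀ : ContDiff ℝ 2 h₀)
    (hgrad_bd : ∃ B : ℝ, ∀ x, ‖gradient h₀ x‖ ≤ B)
    (hgrad_lip : ∃ L : ℝ≥0, LipschitzWith L (gradient h₀))
    (hhess_bd : ∃ B : ℝ, ∀ x, ‖fderiv ℝ (gradient h₀) x‖ ≤ B)
    (hhess_lip : ∃ L : ℝ≥0, LipschitzWith L (fderiv ℝ (gradient h₀)))
    (X0 : EuclideanSpace ℝ (Fin N) → EuclideanSpace ℝ (Fin N))
    (B0 : ℝ) (hX0bd : ∀ w, ‖X0 w‖ ≤ B0) (L0 : ℝ≥0) (hX0lip : LipschitzWith L0 X0)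
    (hX0I : ∀ w, Iproj (X0 w) = 0)
    (hX0θ : ∀ w, θproj (X0 w) = gradient h₀ (Iproj w))
    (X1 : EuclideanSpace ℝ (Fin N) → EuclideanSpace ℝ (Fin N))
    (B1 : ℝ) (hX1bd : ∀ w, ‖X1 w‖ ≤ B1) (L1 : ℝ≥0) (hX1lip : LipschitzWith L1 X1)
    (ε₀ : ℝ) (hε₀ : 0 < ε₀)
    (Φ : ℝ → ℝ × EuclideanSpace ℝ (Fin N) → EuclideanSpace ℝ (Fin N))
    (hflow : ∀ ε ∈ Icc (0:ℝ) ε₀,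
      (∀ w, Φ ε (0, w) = w) ∧
      (∀ (w : EuclideanSpace ℝ (Fin N)) (s : ℝ),
        HasDerivAt (fun σ : ℝ => Φ ε (σ, w)) (X0 (Φ ε (s, w)) + ε • X1 (Φ ε (s, w))) s))
    (C c : ℝ) (hC : 0 < C) (hc : 0 < c) (lam mu : ℝ) (hlam : lam < 0) (hmu : 0 < mu)
    (z zp zm : ℝ → EuclideanSpace ℝ (Fin N))
    (hcontr_p : ∀ ε ∈ Icc (0:ℝ) ε₀, ∀ s : ℝ, 0 ≤ s →
      ‖Φ ε (s, zp ε) - Φ ε (s, z ε)‖ ≤ C * Real.exp (lam * s))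
    (hcontr_m : ∀ ε ∈ Icc (0:ℝ) ε₀, ∀ s : ℝ, s ≤ 0 →
      ‖Φ ε (s, zm ε) - Φ ε (s, z ε)‖ ≤ C * Real.exp (mu * s))
    (hclose : ∀ ε ∈ Icc (0:ℝ) ε₀,
      ‖z ε - z 0‖ ≤ c * ε ∧ ‖zp ε - zp 0‖ ≤ c * ε ∧ ‖zm ε - zm 0‖ ≤ c * ε)
    (hpm : zp 0 = zm 0) :
    Integrable (fun s : ℝ =>
      θproj (X1 (Φ 0 (s, zp 0))) - θproj (X1 (Φ 0 (s, z 0)))) ∧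
    Integrable (fun s : ℝ =>
      s • (Iproj (X1 (Φ 0 (s, zp 0))) - Iproj (X1 (Φ 0 (s, z 0))))) ∧
    ∃ ρ ∈ Ioo (0:ℝ) 1, ∃ K > (0:ℝ), ∃ ε₁ ∈ Ioc (0:ℝ) ε₀, ∀ ε ∈ Ioc (0:ℝ) ε₁,
      ‖θproj (zp ε) - θproj (zm ε) +
        ε • (∫ s : ℝ, (θproj (X1 (Φ 0 (s, zp 0))) - θproj (X1 (Φ 0 (s, z 0))))) -
        ε • (fderiv ℝ (gradient h₀) (Iproj (zp 0))
          (∫ s : ℝ, s • (Iproj (X1 (Φ 0 (s, zp 0))) - Iproj (X1 (Φ 0 (s, z 0))))))‖ ≤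
        K * ε ^ (1 + ρ) := by
  obtain ⟨I, rfl⟩ := exists_continuousLinearMap_of_coordinates hIproj
  obtain ⟨θ, rfl⟩ := exists_continuousLinearMap_of_coordinates hθproj
  have hG : Differentiable ℝ (gradient h₀) := differentiable_gradient hh₀
  obtain ⟨LG, hLG⟩ := hhess_lip
  have hfneg : fderiv ℝ (-gradient h₀) = -fderiv ℝ (gradient h₀) := by
    ext1 w
    simp [fderiv_neg]
  have hz : ∀ ε ∈ Icc 0 ε₀, ∀ w, Φ ε (0, w) = w := fun ε hε => (hflow ε hε).1
  have h00 : (0 : ℝ) ∈ Icc 0 ε₀ := ⟨le_rfl, hε₀.le⟩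
  have hrev : ∀ ε ∈ Icc 0 ε₀, ∀ w s, HasDerivAt (fun σ => Φ ε (-σ, w))
      ((-X0) (Φ ε (-s, w)) + ε • (-X1) (Φ ε (-s, w))) s := fun ε hε w s =>
    (((hflow ε hε).2 w (-s)).scomp s (hasDerivAt_neg s)).congr_deriv (by simp)
  obtain ⟨ip1, ip2, ρp, hρp, Kp, hKp, hp⟩ := angle_displacement_of_forward_asymptotic I θ hG hLG
    hX0lip hX0I hX0θ hX1bd hX1lip hε₀ hC hc hlam
    (x := fun ε s => Φ ε (s, zp ε)) (y := fun ε s => Φ ε (s, z ε))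
    (fun ε hε s => (hflow ε hε).2 _ s) (fun ε hε s => (hflow ε hε).2 _ s) hcontr_p
    (fun ε hε => by simpa only [hz ε hε, hz 0 h00] using (hclose ε hε).2.1)
    (fun ε hε => by simpa only [hz ε hε, hz 0 h00] using (hclose ε hε).1)
  obtain ⟨im1, im2, ρm, hρm, Km, hKm, hm⟩ := angle_displacement_of_forward_asymptotic I θ
    hG.neg (LG := LG) (by rw [hfneg]; exact hLG.neg) (X0 := -X0) (X1 := -X1)
    hX0lip.neg (fun w => by simp [hX0I]) (fun w => by simp [hX0θ])
    (fun w => by simpa using hX1bd w) hX1lip.neg hε₀ hC hc (neg_lt_zero.2 hmu)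
    (x := fun ε s => Φ ε (-s, zm ε)) (y := fun ε s => Φ ε (-s, z ε))
    (fun ε hε s => hrev ε hε _ s) (fun ε hε s => hrev ε hε _ s)
    (fun ε hε s hs => by simpa using hcontr_m ε hε (-s) (neg_nonpos.2 hs))
    (fun ε hε => by simpa only [neg_zero, hz ε hε, hz 0 h00] using (hclose ε hε).2.2)
    (fun ε hε => by simpa only [neg_zero, hz ε hε, hz 0 h00] using (hclose ε hε).1)
  simp only [← hpm, Pi.neg_apply, map_neg, neg_sub_neg] at im1 im2 hm
  set f : ℝ → EuclideanSpace ℝ (Fin d) :=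
    fun s => θ (X1 (Φ 0 (s, zp 0))) - θ (X1 (Φ 0 (s, z 0))) with hf
  set g : ℝ → EuclideanSpace ℝ (Fin d) :=
    fun s => s • (I (X1 (Φ 0 (s, zp 0))) - I (X1 (Φ 0 (s, z 0)))) with hg
  have hf' : ∀ s, θ (X1 (Φ 0 (-s, z 0))) - θ (X1 (Φ 0 (-s, zp 0))) = -f (-s) := fun s => by
    simp [hf]
  have hg' : ∀ s : ℝ, s • (I (X1 (Φ 0 (-s, z 0))) - I (X1 (Φ 0 (-s, zp 0)))) = g (-s) :=
    fun s => by simp [hg, ← smul_neg]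
  simp only [hf', hg', integral_neg, hfneg, Pi.neg_apply] at im1 im2 hm
  obtain ⟨hfi, hfe⟩ := integrable_and_integral_eq_of_Ioi ip1 (by simpa using im1.neg)
  obtain ⟨hgi, hge⟩ := integrable_and_integral_eq_of_Ioi ip2 im2
  refine ⟨hfi, hgi, min ρp ρm, ⟨lt_min hρp.1 hρm.1, min_lt_of_left_lt hρp.2⟩, Kp + Km,
    add_pos hKp hKm, min ε₀ 1, ⟨lt_min hε₀ one_pos, min_le_left _ _⟩, fun ε hε => ?_⟩
  have hε1 : ε ≤ 1 := hε.2.trans (min_le_right _ _)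
  have hεc : ε ∈ Ioc 0 ε₀ := ⟨hε.1, hε.2.trans (min_le_left _ _)⟩
  have hεI : ε ∈ Icc 0 ε₀ := ⟨hε.1.le, hεc.2⟩
  have hp := hp ε hεc hε1
  have hm := hm ε hεc hε1
  simp only [neg_zero, hz ε hεI, hz 0 h00, neg_apply] at hp hm
  have hpp : ε ^ (1 + ρp) ≤ ε ^ (1 + min ρp ρm) :=
    Real.rpow_le_rpow_of_exponent_ge hε.1 hε1 (by gcongr; exact min_le_left _ _)
  have hpm' : ε ^ (1 + ρm) ≤ ε ^ (1 + min ρp ρm) :=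
    Real.rpow_le_rpow_of_exponent_ge hε.1 hε1 (by gcongr; exact min_le_right _ _)
  calc _ = ‖_ - _‖ := by
        rw [hfe, hge]
        congr 1
        rw [← sub_eq_zero]
        simp only [map_add, smul_add, smul_neg]
        abel
    _ ≤ _ := norm_sub_le_of_le hp hm
    _ ≤ Kp * ε ^ (1 + min ρp ρm) + Km * ε ^ (1 + min ρp ρm) := by gcongr
    _ = _ := by ring
end

section
/- Let U ⊆ ℝⁿ be open, M : U → ℝⁿ a C¹ map, and x* ∈ U a non-degenerate zero of M, i.e., M(x*) = 0 and DM(x*) is invertible. Let ε₀, A, ρ > 0 with ρ ≤ 1, and let G : U × (−ε₀,ε₀) → ℝⁿ be of the form G(x,ε) = ε·M(x) + R(x,ε), where for each ε the map x ↦ R(x,ε) is C¹ and satisfies sup_{x∈U} ‖R(x,ε)‖ + sup_{x∈U} ‖D_xR(x,ε)‖ ≤ A·|ε|^{1+ρ}. Then there exists ε₁ ∈ (0,ε₀] such that for every ε with 0 < |ε| < ε₁ there is a point x_ε ∈ U with G(x_ε,ε) = 0 and D_xG(x_ε,ε) invertible, and x_ε → x* as ε → 0. -/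
open MeasureTheory Set

open Metric Filter Topology in
/-- A `C¹` non-degenerate zero `x₀` of `M` persists, with linear control on its displacement, for
every map whose values and derivatives are `η`-close to those of `M`, `η` small. -/
theorem exists_zero_isUnit_fderiv_of_C1_close {E : Type*} [NormedAddCommGroup E]
    [NormedSpace ℝ E] [CompleteSpace E] {U : Set E} (hU : IsOpen U) {M : E → E}
    (hM : ContDiffOn ℝ 1 M U) {x₀ : E} (hx₀ : x₀ ∈ U) (hzero : M x₀ = 0)
    (hunit : IsUnit (fderiv ℝ M x₀)) :
    ∃ C : ℝ, ∃ η₀ > 0, ∀ η, 0 ≤ η → η < η₀ → ∀ S : E → E, DifferentiableOn ℝ S U →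
      (∀ x ∈ U, ‖S x‖ ≤ η) → (∀ x ∈ U, ‖fderiv ℝ S x‖ ≤ η) →
      ∃ x ∈ U, ‖x - x₀‖ ≤ C * η ∧ M x + S x = 0 ∧
        IsUnit (fderiv ℝ (fun y => M y + S y) x) := by
  obtain ⟨L, hL⟩ : ∃ L : E ≃L[ℝ] E, (L : E →L[ℝ] E) = fderiv ℝ M x₀ := by
    obtain ⟨u, hu⟩ := hunit
    exact ⟨ContinuousLinearEquiv.unitsEquiv ℝ E u, by rw [← hu]; rfl⟩
  set K : NNReal := ‖(L.symm : E →L[ℝ] E)‖₊ + 1 with hK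
  have hKpos : (0 : ℝ) < K := by rw [hK]; positivity
  let Linv : (L : E →L[ℝ] E).NonlinearRightInverse :=
    { toFun := L.symm
      nnnorm := K
      bound' := fun y => ((L.symm : E →L[ℝ] E).le_opNorm y).trans <| by
        gcongr
        simp [hK]
      right_inv' := L.apply_symm_apply }
  obtain ⟨d, hd, hdunit⟩ := Metric.isOpen_iff.1 (Units.isOpen (R := E →L[ℝ] E)) _ hunit
  obtain ⟨c, hc, hcK, hcd⟩ : ∃ c : NNReal, 0 < c ∧ (c : ℝ) ≤ (2 * K : ℝ)⁻¹ ∧ (c : ℝ) < d := by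
    have h : 0 < min (2 * K : ℝ)⁻¹ (d / 2) := by positivity
    refine ⟨⟨_, h.le⟩, h, min_le_left _ _, (min_le_right _ _).trans_lt (half_lt_self hd)⟩
  have hcont : ContinuousAt (fderiv ℝ M) x₀ :=
    (hM.continuousOn_fderiv_of_isOpen hU le_rfl).continuousAt (hU.mem_nhds hx₀)
  have hev : ∀ᶠ x in 𝓝 x₀, x ∈ U ∧ fderiv ℝ M x ∈ ball (fderiv ℝ M x₀) (c / 2) :=
    (hU.eventually_mem hx₀).and
      (hcont.eventually_mem (ball_mem_nhds _ (by positivity)))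
  obtain ⟨r, hr, hball⟩ := Metric.eventually_nhds_iff_ball.1 hev
  refine ⟨2 * K, min (c / 2) (r / (2 * K)), by positivity, fun η hη hηlt S hS hS0 hS1 => ?_⟩
  have hηc : η < c / 2 := hηlt.trans_le (min_le_left _ _)
  have hηr : 2 * K * η < r := by
    have := hηlt.trans_le (min_le_right _ _)
    rwa [lt_div_iff₀' (by positivity)] at this
  have hMd : ∀ x ∈ U, DifferentiableAt ℝ M x := fun x hx =>
    (hM.differentiableOn one_ne_zero).differentiableAt (hU.mem_nhds hx)
  have hSd : ∀ x ∈ U, DifferentiableAt ℝ S x := fun x hx => hS.differentiableAt (hU.mem_nhds hx)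
  have hclose : ∀ x ∈ ball x₀ r, ‖fderiv ℝ (fun y => M y + S y) x - L‖ ≤ c := by
    intro x hx
    obtain ⟨hxU, hxM⟩ := hball x hx
    rw [fderiv_fun_add (hMd x hxU) (hSd x hxU), hL, add_sub_right_comm]
    rw [mem_ball, dist_eq_norm] at hxM
    linarith [norm_add_le (fderiv ℝ M x - fderiv ℝ M x₀) (fderiv ℝ S x), hS1 x hxU]
  have happrox : ApproximatesLinearOn (fun y => M y + S y) (L : E →L[ℝ] E) (ball x₀ r) c := by
    intro x hx y hy
    exact (convex_ball x₀ r).norm_image_sub_le_of_norm_fderiv_le'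
      (fun z hz => (hMd z (hball z hz).1).add (hSd z (hball z hz).1)) hclose hy hx
  have hsurj := happrox.surjOn_closedBall_of_nonlinearRightInverse Linv
    (ε := 2 * K * η) (b := x₀) (by positivity) (closedBall_subset_ball hηr)
  have hmem : (0 : E) ∈ closedBall (M x₀ + S x₀) (((K : ℝ)⁻¹ - c) * (2 * K * η)) := by
    rw [mem_closedBall, dist_eq_norm, zero_sub, norm_neg, hzero, zero_add]
    refine (hS0 x₀ hx₀).trans ?_
    calc η = ((K : ℝ)⁻¹ - (2 * K : ℝ)⁻¹) * (2 * K * η) := by field_simp; ring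
      _ ≤ _ := by gcongr
  obtain ⟨x, hx, hx0⟩ := hsurj hmem
  have hxr := closedBall_subset_ball hηr hx
  refine ⟨x, (hball x hxr).1, by rwa [mem_closedBall, dist_eq_norm] at hx, hx0, hdunit ?_⟩
  rw [mem_ball, dist_eq_norm, ← hL]
  exact (hclose x hxr).trans_lt hcd

/-- Persistence of non-degenerate zeros under `O(ε^{1+ρ})` perturbations:
if `M` has a non-degenerate zero `x*` and `G(x,ε) = ε·M(x) + R(x,ε)` with
`‖R(·,ε)‖_{C¹} ≤ A|ε|^{1+ρ}`, then for all small `ε ≠ 0` the map `G(·,ε)` has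
a zero `x_ε` near `x*` at which `D_xG(x_ε,ε)` is invertible, and `x_ε → x*`
as `ε → 0`. -/
theorem stmt_11 {n : ℕ}
    (U : Set (EuclideanSpace ℝ (Fin n))) (hU : IsOpen U)
    (M : EuclideanSpace ℝ (Fin n) → EuclideanSpace ℝ (Fin n))
    (hM : ContDiffOn ℝ 1 M U)
    (xstar : EuclideanSpace ℝ (Fin n)) (hxstar : xstar ∈ U)
    (hzero : M xstar = 0) (hnondeg : IsUnit (fderiv ℝ M xstar))
    (ε₀ A ρ : ℝ) (hε₀ : 0 < ε₀) (hA : 0 < A) (hρ : 0 < ρ) (hρ1 : ρ ≤ 1)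
    (G R : EuclideanSpace ℝ (Fin n) → ℝ → EuclideanSpace ℝ (Fin n))
    (hG : ∀ x ε, G x ε = ε • M x + R x ε)
    (hRC1 : ∀ ε : ℝ, |ε| < ε₀ → ContDiffOn ℝ 1 (fun x => R x ε) U)
    (hRsmall : ∀ ε : ℝ, |ε| < ε₀ → ∀ x ∈ U,
      ‖R x ε‖ + ‖fderiv ℝ (fun y => R y ε) x‖ ≤ A * |ε| ^ (1 + ρ)) :
    ∃ ε₁ ∈ Ioc (0:ℝ) ε₀, ∃ xe : ℝ → EuclideanSpace ℝ (Fin n),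
      (∀ ε : ℝ, 0 < |ε| → |ε| < ε₁ →
        xe ε ∈ U ∧ G (xe ε) ε = 0 ∧ IsUnit (fderiv ℝ (fun x => G x ε) (xe ε))) ∧
      Filter.Tendsto xe (nhdsWithin 0 {ε : ℝ | ε ≠ 0}) (nhds xstar) := by
  obtain ⟨C, η₀, hη₀, hpersist⟩ :=
    exists_zero_isUnit_fderiv_of_C1_close hU hM hxstar hzero hnondeg
  have hlim : Filter.Tendsto (fun ε : ℝ => A * |ε| ^ ρ) (nhds 0) (nhds 0) := by
    have h : Continuous fun ε : ℝ => A * |ε| ^ ρ :=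
      continuous_const.mul (continuous_abs.rpow_const fun _ => Or.inr hρ.le)
    simpa [Real.zero_rpow hρ.ne'] using h.tendsto 0
  obtain ⟨δ, hδ, hδη⟩ := Metric.eventually_nhds_iff.1 (hlim.eventually_lt_const hη₀)
  have hex : ∀ ε : ℝ, 0 < |ε| → |ε| < min δ ε₀ → ∃ x ∈ U, ‖x - xstar‖ ≤ C * (A * |ε| ^ ρ) ∧
      G x ε = 0 ∧ IsUnit (fderiv ℝ (fun x => G x ε) x) := by
    intro ε hε hlt
    have hεne : ε ≠ 0 := abs_pos.1 hε
    have hε' : |ε| < ε₀ := hlt.trans_le (min_le_right _ _)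
    have hscale : |ε|⁻¹ * (A * |ε| ^ (1 + ρ)) = A * |ε| ^ ρ := by
      rw [Real.rpow_add hε, Real.rpow_one]
      field_simp
    have hRd : DifferentiableOn ℝ (fun x => R x ε) U := (hRC1 ε hε').differentiableOn one_ne_zero
    obtain ⟨x, hxU, hx, hx0, hxunit⟩ := hpersist (A * |ε| ^ ρ) (by positivity)
      (hδη (by simpa using hlt.trans_le (min_le_left _ _))) (fun x => ε⁻¹ • R x ε)
      (hRd.fun_const_smul _)
      (fun x hx => by
        rw [norm_smul, norm_inv, Real.norm_eq_abs, ← hscale]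
        gcongr
        linarith [hRsmall ε hε' x hx, norm_nonneg (fderiv ℝ (fun y => R y ε) x)])
      (fun x hx => by
        rw [fderiv_fun_const_smul (hRd.differentiableAt (hU.mem_nhds hx)), norm_smul, norm_inv,
          Real.norm_eq_abs, ← hscale]
        gcongr
        linarith [hRsmall ε hε' x hx, norm_nonneg (R x ε)])
    have hGeq : ∀ y, G y ε = ε • (M y + ε⁻¹ • R y ε) := fun y => by
      rw [hG, smul_add, smul_inv_smul₀ hεne]
    refine ⟨x, hxU, hx, by rw [hGeq, hx0, smul_zero], ?_⟩
    simp_rw [hGeq]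
    rw [fderiv_fun_const_smul]
    · exact hxunit.smul (Units.mk0 ε hεne)
    · exact ((hM.differentiableOn one_ne_zero).differentiableAt (hU.mem_nhds hxU)).add
        ((hRd.differentiableAt (hU.mem_nhds hxU)).fun_const_smul _)
  choose! xe hxeU hxe hxe0 hxeunit using hex
  have hε₁ : 0 < min δ ε₀ := lt_min hδ hε₀
  refine ⟨min δ ε₀, ⟨hε₁, min_le_right _ _⟩, xe,
    fun ε h h' => ⟨hxeU ε h h', hxe0 ε h h', hxeunit ε h h'⟩, ?_⟩
  rw [tendsto_iff_norm_sub_tendsto_zero]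
  refine squeeze_zero' (.of_forall fun _ => norm_nonneg _) ?_
    (g := fun ε : ℝ => C * (A * |ε| ^ ρ)) ?_
  · have hsmall : ∀ᶠ ε : ℝ in nhds 0, |ε| < min δ ε₀ :=
      Metric.eventually_nhds_iff.2 ⟨_, hε₁, fun ε h => by simpa using h⟩
    filter_upwards [self_mem_nhdsWithin, hsmall.filter_mono nhdsWithin_le_nhds] with ε h h'
    exact hxe ε (abs_pos.2 h) h'
  · simpa using (hlim.const_mul C).mono_left nhdsWithin_le_nhds
end

section
/- Let f : ℝ^m × ℝ^d → ℝ be C¹ with bounded derivative, and assume that the partial derivative D₂f : ℝ^m × ℝ^d → (ℝ^d)* (with respect to the second argument) is Lipschitz. Let g : ℝ → ℝ^m be continuous with ‖g(s)‖ ≤ C·exp(−a·|s|) for all s ∈ ℝ, for some constants C, a > 0, and let ω ∈ ℝ^d. Define M : ℝ^d → ℝ by M(θ) = ∫_{−∞}^{+∞} (f(g(s), θ + s·ω) − f(0, θ + s·ω)) ds. Then M is well defined and differentiable, and for all θ ∈ ℝ^d: DM(θ) = ∫_{−∞}^{+∞} (D₂f(g(s), θ + s·ω) − D₂f(0, θ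 + s·ω)) ds. -/
open MeasureTheory Set
open scoped NNReal

theorem integrable_exp_neg_mul_abs {a : ℝ} (ha : 0 < a) :
    Integrable fun s : ℝ => Real.exp (-a * |s|) := by
  refine .of_integral_ne_zero ?_
  rw [integral_comp_abs (f := fun x => Real.exp (-a * x)), integral_exp_mul_Ioi (neg_lt_zero.2 ha)]
  simp [ha.ne']

theorem LipschitzWith.norm_sub_fst_zero_le {E F G ι : Type*} [NormedAddCommGroup E]
    [NormedAddCommGroup F] [NormedAddCommGroup G] {K : ℝ≥0} {φ : E × F → G}
    (hφ : LipschitzWith K φ) {g : ι → E} {b : ι → ℝ} (hgb : ∀ s, ‖g s‖ ≤ b s) (s : ι) (y : F) :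
    ‖φ (g s, y) - φ (0, y)‖ ≤ K * b s :=
  calc ‖φ (g s, y) - φ (0, y)‖ ≤ K * ‖(g s, y) - (0, y)‖ := hφ.norm_sub_le _ _
    _ = K * ‖g s‖ := by simp [Prod.norm_def]
    _ ≤ K * b s := by gcongr; exact hgb s

/-- If `g` decays exponentially, the values of a Lipschitz function along `(g, γ)` and along
`(0, γ)` have integrable difference. -/
theorem LipschitzWith.integrable_sub_of_exp_decay {E F G : Type*} [NormedAddCommGroup E]
    [NormedAddCommGroup F] [NormedAddCommGroup G] {K : ℝ≥0} {φ : E × F → G}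
    (hφ : LipschitzWith K φ) {g : ℝ → E} (hg : Continuous g) {C a : ℝ} (ha : 0 < a)
    (hdecay : ∀ s, ‖g s‖ ≤ C * Real.exp (-a * |s|)) {γ : ℝ → F} (hγ : Continuous γ) :
    Integrable fun s : ℝ => φ (g s, γ s) - φ (0, γ s) := by
  have hcont : Continuous fun s : ℝ => φ (g s, γ s) - φ (0, γ s) :=
    (hφ.continuous.comp (hg.prodMk hγ)).sub (hφ.continuous.comp (continuous_const.prodMk hγ))
  exact (((integrable_exp_neg_mul_abs ha).const_mul C).const_mul K).mono'
    hcont.aestronglyMeasurable (ae_of_all _ fun s => hφ.norm_sub_fst_zero_le hdecay s (γ s))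

/-- Differentiation under the integral sign for Melnikov integrals:
for `f` of class `C¹` with bounded derivative and Lipschitz partial derivative
`D₂f` in the second argument, and `g` continuous with exponential decay, the
function `M(θ) = ∫_ℝ (f(g(s), θ+sω) − f(0, θ+sω)) ds` is well defined and
differentiable, with `DM(θ) = ∫_ℝ (D₂f(g(s), θ+sω) − D₂f(0, θ+sω)) ds`. -/
theorem stmt_16 {m d : ℕ}
    (f : EuclideanSpace ℝ (Fin m) × EuclideanSpace ℝ (Fin d) → ℝ)
    (hf : ContDiff ℝ 1 f)
    (B : ℝ) (hfd_bd : ∀ x, ‖fderiv ℝ f x‖ ≤ B)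
    (L : ℝ≥0)
    (hD2lip : LipschitzWith L
      (fun p : EuclideanSpace ℝ (Fin m) × EuclideanSpace ℝ (Fin d) =>
        fderiv ℝ (fun y => f (p.1, y)) p.2))
    (g : ℝ → EuclideanSpace ℝ (Fin m)) (hg : Continuous g)
    (C a : ℝ) (hC : 0 < C) (ha : 0 < a)
    (hdecay : ∀ s : ℝ, ‖g s‖ ≤ C * Real.exp (-a * |s|))
    (ω : EuclideanSpace ℝ (Fin d)) :
    (∀ θ : EuclideanSpace ℝ (Fin d),
      Integrable (fun s : ℝ => f (g s, θ + s • ω) - f (0, θ + s • ω)) ∧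
      Integrable (fun s : ℝ =>
        fderiv ℝ (fun y => f (g s, y)) (θ + s • ω) -
        fderiv ℝ (fun y => f (0, y)) (θ + s • ω))) ∧
    ∀ θ : EuclideanSpace ℝ (Fin d),
      HasFDerivAt (fun θ' => ∫ s : ℝ, (f (g s, θ' + s • ω) - f (0, θ' + s • ω)))
        (∫ s : ℝ, (fderiv ℝ (fun y => f (g s, y)) (θ + s • ω) -
          fderiv ℝ (fun y => f (0, y)) (θ + s • ω))) θ := by
  have hB : 0 ≤ B := (norm_nonneg _).trans (hfd_bd 0)
  have hdiff : Differentiable ℝ f := hf.differentiable one_ne_zero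
  have hflip : LipschitzWith B.toNNReal f :=
    lipschitzWith_of_nnnorm_fderiv_le hdiff fun x => by
      rw [← NNReal.coe_le_coe, Real.coe_toNNReal _ hB]
      exact hfd_bd x
  have hγ (θ : EuclideanSpace ℝ (Fin d)) : Continuous fun s : ℝ => θ + s • ω := by fun_prop
  have hint θ := hflip.integrable_sub_of_exp_decay hg ha hdecay (hγ θ)
  have hint' θ := hD2lip.integrable_sub_of_exp_decay hg ha hdecay (hγ θ)
  have hpartial (x : EuclideanSpace ℝ (Fin m)) (θ : EuclideanSpace ℝ (Fin d)) (s : ℝ) :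
      HasFDerivAt (fun θ' => f (x, θ' + s • ω)) (fderiv ℝ (fun y => f (x, y)) (θ + s • ω)) θ :=
    (hasFDerivAt_comp_add_right (f := fun y => f (x, y)) (s • ω)).2
      (hdiff.comp (by fun_prop : Differentiable ℝ fun y => (x, y)) _).hasFDerivAt
  refine ⟨fun θ => ⟨hint θ, hint' θ⟩, fun θ => ?_⟩
  refine hasFDerivAt_integral_of_dominated_of_fderiv_le
    (F' := fun θ' s => fderiv ℝ (fun y => f (g s, y)) (θ' + s • ω) -
      fderiv ℝ (fun y => f (0, y)) (θ' + s • ω))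
    (bound := fun s => L * (C * Real.exp (-a * |s|))) Filter.univ_mem
    (Filter.Eventually.of_forall fun θ' => (hint θ').aestronglyMeasurable) (hint θ)
    (hint' θ).aestronglyMeasurable (ae_of_all _ fun s θ' _ => ?_)
    (((integrable_exp_neg_mul_abs ha).const_mul C).const_mul L)
    (ae_of_all _ fun s θ' _ => (hpartial (g s) θ' s).sub (hpartial 0 θ' s))
  exact hD2lip.norm_sub_fst_zero_le hdecay s _
end
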